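/- There exist vectors p₁, p₂, p₃ ∈ ℝ⁴, matrices L₁, L₂, L₃ ∈ ℝ^{2×4}, and matrices H₁, H₂, H₃ ∈ ℝ^{3×4} such that the set S of equivalence classes, under multiplication by nonzero complex scalars, of symmetric 4×4 complex matrices X with det X ≠ 0 satisfying p_i X p_iᵀ = 0 for i = 1,2,3, det(L_j X L_jᵀ) = 0 for j = 1,2,3, and det(H_k X H_kᵀ) = 0 for k = 1,2,3, is finite with exactly 104 elements, and every class in S contains a matrix all of whose entries are real. -/

import Mathlib

open Matrix

/-- The value at `y` of the quadratic form with integer coefficient matrix `G`. -/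
def quadEval {ι R : Type*} [Fintype ι] [CommRing R] (G : ι → ι → ℤ) (y : ι → R) : R :=
  ∑ k, ∑ l, (G k l : R) * y k * y l

lemma quadEval_cons {R : Type*} [CommRing R] {n : ℕ} (G : Fin (n + 1) → Fin (n + 1) → ℤ)
    (c : R) (x : Fin n → R) :
    quadEval G (Fin.cons c x : Fin (n + 1) → R) =
      (G 0 0 : R) * c * c + ∑ k : Fin n, ((G k.succ 0 : R) + G 0 k.succ) * c * x k +
        ∑ k : Fin n, ∑ l : Fin n, (G k.succ l.succ : R) * x k * x l := by
  simp only [quadEval, Fin.sum_univ_succ, Fin.cons_zero, Fin.cons_succ, Finset.sum_add_distrib,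
    add_mul]
  have h2 : ∑ k : Fin n, (G k.succ 0 : R) * x k * c = ∑ k : Fin n, (G k.succ 0 : R) * c * x k :=
    Finset.sum_congr rfl fun _ _ => by ring
  rw [h2]
  ring

/-- The row sums controlling Newton's method for the quadratic system `G` at the approximate zero
`X / N`, with preconditioner `A / D`. -/
def newtonBound {n : ℕ} (G : Fin n → Fin (n + 1) → Fin (n + 1) → ℤ) (N D : ℤ) (X : Fin n → ℤ)
    (A : Fin n → Fin n → ℤ) (i : Fin n) : ℤ :=
  |∑ m, A i m * quadEval (G m) (Fin.cons N X : Fin (n + 1) → ℤ)| +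
    ∑ k : Fin n, |∑ m, A i m * (∑ p : Fin (n + 1), (G m k.succ p + G m p k.succ) *
      (Fin.cons N X : Fin (n + 1) → ℤ) p) - if i = k then D else 0| +
    2 * ∑ k : Fin n, ∑ l : Fin n, |∑ m, A i m * G m k.succ l.succ|

lemma quadEval_add {ι R : Type*} [Fintype ι] [CommRing R] (G : ι → ι → ℤ) (y z : ι → R) :
    quadEval G (y + z) = quadEval G y +
      ∑ k, (∑ p, ((G k p : R) + G p k) * y p) * z k + quadEval G z := by
  have h : ∑ k, (∑ p, ((G k p : R) + G p k) * y p) * z k =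
      ∑ k, ∑ p, (G k p : R) * y k * z p + ∑ k, ∑ p, (G k p : R) * z k * y p := by
    rw [Finset.sum_comm (f := fun k p => (G k p : R) * y k * z p), ← Finset.sum_add_distrib]
    refine Finset.sum_congr rfl fun k _ => ?_
    rw [Finset.sum_mul, ← Finset.sum_add_distrib]
    exact Finset.sum_congr rfl fun p _ => by ring
  rw [h]
  simp only [quadEval, Pi.add_apply, ← Finset.sum_add_distrib]
  exact Finset.sum_congr rfl fun k _ => Finset.sum_congr rfl fun p _ => by ring

/-- A quadratic map `t ↦ t - (c + B t + q t)` with small coefficients is a contraction of the unit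
cube, and so `c + B t + q t` has a zero there. -/
lemma exists_zero_of_contraction {n : ℕ} (c : Fin n → ℝ) (B : Fin n → Fin n → ℝ)
    (Q : Fin n → Fin n → Fin n → ℝ) (θ : ℝ) (hθ : θ < 1) (h0 : 0 ≤ θ)
    (h : ∀ i, |c i| + ∑ k, |B i k - if i = k then 1 else 0| + 2 * ∑ k, ∑ l, |Q i k l| ≤ θ) :
    ∃ t : Fin n → ℝ, (∀ i, |t i| ≤ 1) ∧
      ∀ i, c i + ∑ k, B i k * t k + ∑ k, ∑ l, Q i k l * t k * t l = 0 := by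
  set E : Fin n → Fin n → ℝ := fun i k => B i k - if i = k then 1 else 0 with hE
  set f : (Fin n → ℝ) → Fin n → ℝ := fun t i =>
    - (c i + ∑ k, E i k * t k + ∑ k, ∑ l, Q i k l * t k * t l) with hf
  set s : Set (Fin n → ℝ) := Metric.closedBall 0 1 with hs
  have hmem : ∀ t, t ∈ s ↔ ∀ i, |t i| ≤ 1 := by
    intro t
    rw [hs, mem_closedBall_zero_iff, pi_norm_le_iff_of_nonneg zero_le_one]
    rfl
  have hmaps : Set.MapsTo f s s := by
    intro t ht
    rw [hmem] at ht ⊢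
    intro i
    have h1 : |∑ k, E i k * t k| ≤ ∑ k, |E i k| := by
      refine (Finset.abs_sum_le_sum_abs _ _).trans (Finset.sum_le_sum fun k _ => ?_)
      rw [abs_mul]
      exact mul_le_of_le_one_right (abs_nonneg _) (ht k)
    have h2 : |∑ k, ∑ l, Q i k l * t k * t l| ≤ ∑ k, ∑ l, |Q i k l| := by
      refine (Finset.abs_sum_le_sum_abs _ _).trans (Finset.sum_le_sum fun k _ => ?_)
      refine (Finset.abs_sum_le_sum_abs _ _).trans (Finset.sum_le_sum fun l _ => ?_)
      rw [abs_mul, abs_mul, mul_assoc]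
      exact mul_le_of_le_one_right (abs_nonneg _)
        (mul_le_one₀ (ht k) (abs_nonneg _) (ht l))
    have h3 : (0 : ℝ) ≤ ∑ k, ∑ l, |Q i k l| := by positivity
    simp only [hf, abs_neg]
    refine (abs_add_le _ _).trans ?_
    have := abs_add_le (c i) (∑ k, E i k * t k)
    linarith [h i]
  have hlip : ∀ t ∈ s, ∀ u ∈ s, dist (f t) (f u) ≤ θ * dist t u := by
    intro t ht u hu
    rw [hmem] at ht hu
    rw [dist_pi_le_iff (by positivity)]
    intro i
    have hd : ∀ k, |t k - u k| ≤ dist t u := fun k => by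
      rw [← Real.dist_eq]; exact dist_le_pi_dist t u k
    have h1 : |∑ k, E i k * (t k - u k)| ≤ (∑ k, |E i k|) * dist t u := by
      rw [Finset.sum_mul]
      refine (Finset.abs_sum_le_sum_abs _ _).trans (Finset.sum_le_sum fun k _ => ?_)
      rw [abs_mul]
      exact mul_le_mul_of_nonneg_left (hd k) (abs_nonneg _)
    have h2 : |∑ k, ∑ l, Q i k l * (t k * t l - u k * u l)| ≤
        2 * (∑ k, ∑ l, |Q i k l|) * dist t u := by
      rw [mul_assoc, Finset.sum_mul, Finset.mul_sum]
      refine (Finset.abs_sum_le_sum_abs _ _).trans (Finset.sum_le_sum fun k _ => ?_)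
      rw [Finset.sum_mul, Finset.mul_sum]
      refine (Finset.abs_sum_le_sum_abs _ _).trans (Finset.sum_le_sum fun l _ => ?_)
      rw [abs_mul, mul_left_comm]
      refine mul_le_mul_of_nonneg_left ?_ (abs_nonneg _)
      have e : t k * t l - u k * u l = (t k - u k) * t l + u k * (t l - u l) := by ring
      rw [e]
      refine (abs_add_le _ _).trans ?_
      rw [abs_mul, abs_mul]
      have h4 := mul_le_mul (hd k) (ht l) (abs_nonneg _) dist_nonneg
      have h5 := mul_le_mul (hu k) (hd l) (abs_nonneg _) zero_le_one
      linarith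
    have e : f t i - f u i = -(∑ k, E i k * (t k - u k) +
        ∑ k, ∑ l, Q i k l * (t k * t l - u k * u l)) := by
      simp only [hf, mul_sub, Finset.sum_sub_distrib, mul_assoc]
      ring
    rw [Real.dist_eq, e, abs_neg]
    refine (abs_add_le _ _).trans ?_
    have h6 : (∑ k, |E i k|) + 2 * (∑ k, ∑ l, |Q i k l|) ≤ θ := by
      linarith [h i, abs_nonneg (c i)]
    calc _ ≤ ((∑ k, |E i k|) + 2 * (∑ k, ∑ l, |Q i k l|)) * dist t u := by linarith
      _ ≤ _ := mul_le_mul_of_nonneg_right h6 dist_nonneg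
  have hc : ContractingWith ⟨θ, h0⟩ (hmaps.restrict f s s) := by
    refine ⟨by exact_mod_cast hθ, LipschitzWith.of_dist_le_mul fun t u => ?_⟩
    exact hlip t t.2 u u.2
  obtain ⟨t, hts, hfix, -⟩ := hc.exists_fixedPoint' (x := 0)
    (Metric.isClosed_closedBall.isComplete) hmaps (by simp [hs]) (edist_ne_top _ _)
  refine ⟨t, (hmem t).1 hts, fun i => ?_⟩
  have hi : f t i = t i := congrFun hfix i
  have e : ∑ k, B i k * t k = ∑ k, E i k * t k + t i := by
    simp [hE, sub_mul, Finset.sum_sub_distrib]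
  rw [e, ← hi]
  simp only [hf]
  ring

lemma exists_zero_of_newtonBound {n : ℕ} (G : Fin n → Fin (n + 1) → Fin (n + 1) → ℤ) (N D : ℤ)
    (X : Fin n → ℤ) (A : Fin n → Fin n → ℤ) (hN : 0 < N) (hD : 0 < D)
    (h : ∀ i, newtonBound G N D X A i < D) :
    ∃ x : Fin n → ℝ, (∀ i, |N * x i - X i| ≤ 1) ∧
      ∀ m, quadEval (G m) (Fin.cons 1 x : Fin (n + 1) → ℝ) = 0 := by
  set y : Fin (n + 1) → ℤ := Fin.cons N X with hy
  set J : Matrix (Fin n) (Fin n) ℝ := fun m k =>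
    ∑ p : Fin (n + 1), ((G m k.succ p : ℝ) + G m p k.succ) * y p with hJ
  set A' : Matrix (Fin n) (Fin n) ℝ := fun i m => A i m with hA'
  set c : Fin n → ℝ := fun i => (∑ m, A' i m * quadEval (G m) (fun p => (y p : ℝ))) / D with hc
  set B : Fin n → Fin n → ℝ := fun i k => (A' * J) i k / D with hB
  set Q : Fin n → Fin n → Fin n → ℝ := fun i k l =>
    (∑ m, A' i m * G m k.succ l.succ) / D with hQ
  have hDR : (0 : ℝ) < D := by exact_mod_cast hD
  have key : ∀ i, |c i| + ∑ k, |B i k - if i = k then 1 else 0| + 2 * ∑ k, ∑ l, |Q i k l| =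
      (newtonBound G N D X A i : ℝ) / D := by
    intro i
    have e1 : ∀ k, B i k - (if i = k then 1 else 0) =
        ((A' * J) i k - if i = k then (D : ℝ) else 0) / D := by
      intro k
      rw [sub_div]
      congr 1
      split_ifs
      · rw [div_self hDR.ne']
      · simp
    simp only [e1, hc, hQ, abs_div, abs_of_pos hDR, ← Finset.sum_div]
    rw [← mul_div_assoc, ← add_div, ← add_div]
    congr 1
    simp only [newtonBound, ← hy]
    push_cast
    simp only [hJ, hA', quadEval]
    push_cast
    rfl
  have hle : ∀ i, (newtonBound G N D X A i : ℝ) / D ≤ ((D : ℝ) - 1) / D := by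
    intro i
    refine div_le_div_of_nonneg_right ?_ hDR.le
    have := Int.le_sub_one_of_lt (h i)
    exact_mod_cast this
  have hD1 : (1 : ℝ) ≤ D := by exact_mod_cast hD
  obtain ⟨t, ht, hz⟩ := exists_zero_of_contraction c B Q (((D : ℝ) - 1) / D)
    (by rw [div_lt_one hDR]; linarith) (div_nonneg (by linarith) hDR.le)
    (fun i => (key i).le.trans (hle i))
  have hlt : ∀ i, (newtonBound G N D X A i : ℝ) < D := fun i => by exact_mod_cast h i
  have hdet : (A' * J).det ≠ 0 := by
    apply det_ne_zero_of_sum_row_lt_diag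
    intro i
    have h1 : ∑ k, |(A' * J) i k - if i = k then (D : ℝ) else 0| < D := by
      have e : ∑ k, |B i k - if i = k then 1 else 0| =
          (∑ k, |(A' * J) i k - if i = k then (D : ℝ) else 0|) / D := by
        rw [Finset.sum_div]
        refine Finset.sum_congr rfl fun k _ => ?_
        rw [← abs_of_pos hDR, ← abs_div, abs_of_pos hDR, sub_div]
        congr 2
        split_ifs
        · rw [div_self hDR.ne']
        · simp
      have h3 : (0 : ℝ) ≤ ∑ k, ∑ l, |Q i k l| := by positivity
      have h4 : ∑ k, |B i k - if i = k then 1 else 0| < 1 := by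
        have := (key i).le.trans (hle i)
        have h5 : ((D : ℝ) - 1) / D < 1 := by rw [div_lt_one hDR]; linarith
        linarith [abs_nonneg (c i)]
      rwa [e, div_lt_one hDR] at h4
    rw [← Finset.add_sum_erase _ _ (Finset.mem_univ i)] at h1
    have h2 : ∑ k ∈ Finset.univ.erase i, |(A' * J) i k - if i = k then (D : ℝ) else 0| =
        ∑ k ∈ Finset.univ.erase i, ‖(A' * J) i k‖ := by
      refine Finset.sum_congr rfl fun k hk => ?_
      rw [if_neg (Finset.ne_of_mem_erase hk).symm, sub_zero, Real.norm_eq_abs]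
    rw [h2, if_pos rfl] at h1
    have h3 : D - |(A' * J) i i - D| ≤ ‖(A' * J) i i‖ := by
      rw [Real.norm_eq_abs]
      have := abs_sub_abs_le_abs_sub (D : ℝ) ((A' * J) i i)
      rw [abs_of_pos hDR, abs_sub_comm] at this
      linarith
    linarith
  have hA : A'.det ≠ 0 := fun h0 => hdet (by rw [Matrix.det_mul, h0, zero_mul])
  set F : Fin n → ℝ := fun m => quadEval (G m) (Fin.cons (N : ℝ) (fun k => X k + t k) :
    Fin (n + 1) → ℝ) with hF
  have hFe : ∀ m, F m = quadEval (G m) (fun p => (y p : ℝ)) + ∑ k, J m k * t k +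
      ∑ k : Fin n, ∑ l : Fin n, (G m k.succ l.succ : ℝ) * t k * t l := by
    intro m
    have e : (Fin.cons (N : ℝ) (fun k => X k + t k) : Fin (n + 1) → ℝ) =
        (fun p => (y p : ℝ)) + (Fin.cons 0 t : Fin (n + 1) → ℝ) := by
      ext p
      refine Fin.cases ?_ (fun k => ?_) p <;> simp [hy]
    simp only [hF]
    rw [e, quadEval_add, quadEval_cons, Fin.sum_univ_succ]
    simp [hJ]
  have hAF : A'.mulVec F = 0 := by
    ext i
    have h1 := hz i
    simp only [Matrix.mulVec, dotProduct, Pi.zero_apply]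
    have e : ∑ m, A' i m * F m = D * (c i + ∑ k, B i k * t k + ∑ k, ∑ l, Q i k l * t k * t l) := by
      have e1 : (D : ℝ) * c i = ∑ m, A' i m * quadEval (G m) (fun p => (y p : ℝ)) := by
        simp only [hc]; field_simp
      have e2 : (D : ℝ) * ∑ k, B i k * t k = ∑ m, A' i m * ∑ k, J m k * t k := by
        simp only [hB, Matrix.mul_apply, Finset.mul_sum]
        rw [Finset.sum_comm]
        refine Finset.sum_congr rfl fun k _ => ?_
        rw [← mul_assoc, mul_div_cancel₀ _ hDR.ne', Finset.sum_mul]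
        exact Finset.sum_congr rfl fun m _ => by ring
      have e3 : (D : ℝ) * ∑ k, ∑ l, Q i k l * t k * t l =
          ∑ m, A' i m * ∑ k : Fin n, ∑ l : Fin n, (G m k.succ l.succ : ℝ) * t k * t l := by
        simp only [hQ, Finset.mul_sum]
        rw [Finset.sum_comm (s := (Finset.univ : Finset (Fin n))) (t := Finset.univ)
          (f := fun m k => ∑ l, A' i m * ((G m k.succ l.succ : ℝ) * t k * t l))]
        refine Finset.sum_congr rfl fun k _ => ?_
        rw [Finset.sum_comm]
        refine Finset.sum_congr rfl fun l _ => ?_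
        rw [← mul_assoc, ← mul_assoc, mul_div_cancel₀ _ hDR.ne', Finset.sum_mul, Finset.sum_mul]
        exact Finset.sum_congr rfl fun m _ => by ring
      rw [mul_add, mul_add, e1, e2, e3, ← Finset.sum_add_distrib, ← Finset.sum_add_distrib]
      refine Finset.sum_congr rfl fun m _ => ?_
      rw [hFe]
      ring
    rw [e, h1, mul_zero]
  have hF0 : F = 0 := Matrix.eq_zero_of_mulVec_eq_zero hA hAF
  have hNR : (N : ℝ) ≠ 0 := by exact_mod_cast hN.ne'
  refine ⟨fun k => (X k + t k) / N, fun i => ?_, fun m => ?_⟩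
  · rw [mul_div_cancel₀ _ hNR, add_sub_cancel_left]
    exact ht i
  · have h1 : F m = 0 := congrFun hF0 m
    have e : F m = (N : ℝ) ^ 2 *
        quadEval (G m) (Fin.cons 1 (fun k => (X k + t k) / N) : Fin (n + 1) → ℝ) := by
      have e2 : (Fin.cons (N : ℝ) (fun k => X k + t k) : Fin (n + 1) → ℝ) =
          fun p => (N : ℝ) * (Fin.cons 1 (fun k => (X k + t k) / N) : Fin (n + 1) → ℝ) p := by
        ext p
        refine Fin.cases ?_ (fun k => ?_) p
        · simp
        · simp [mul_div_cancel₀ _ hNR]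
      simp only [hF]
      rw [e2]
      simp only [quadEval, Finset.mul_sum]
      exact Finset.sum_congr rfl fun k _ => Finset.sum_congr rfl fun p _ => by ring
    rw [e] at h1
    exact (mul_eq_zero.1 h1).resolve_left (pow_ne_zero 2 hNR)

section UpperBound

variable {R : Type*} [CommRing R]

/-- If the squares of `u₁, u₂, u₃` lie in `2 M²` and products of generators of `M` with the `γ i`
are controlled by the `γ i` and `γ i u j`, then modulo `2` the powers of `M` are spanned by the
products of some `γ i` with a squarefree monomial in the `u j`. -/
lemma pow_le_span_sup_two_mul {ι : Type*} (X : Set R) (h1 : (1 : R) ∈ X) (u : Fin 3 → R)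
    (hu : ∀ j, u j ∈ Submodule.span ℤ X)
    (hsq : ∀ j, ∃ z ∈ Submodule.span ℤ X ^ 2, u j ^ 2 = 2 * z) (γ : ι → R) (δ : ι → ℕ)
    (hγ : ∀ i, γ i ∈ Submodule.span ℤ X ^ δ i) (i₀ : ι) (hi₀ : γ i₀ = 1) (hδ : δ i₀ = 0)
    (hmul : ∀ x ∈ X, ∀ i, γ i * x ∈ Submodule.span ℤ
      ({y | ∃ i', δ i' ≤ δ i + 1 ∧ y = γ i'} ∪ {y | ∃ i' j, δ i' ≤ δ i ∧ y = γ i' * u j})) (k : ℕ) :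
    Submodule.span ℤ X ^ k ≤
      Submodule.span ℤ {y | ∃ i, ∃ b : Finset (Fin 3), δ i + b.card ≤ k ∧ y = γ i * ∏ j ∈ b, u j} ⊔
        Submodule.span ℤ {(2 : R)} * Submodule.span ℤ X ^ k := by
  set M := Submodule.span ℤ X with hM
  have hone : 1 ≤ M := Submodule.one_le.2 (Submodule.subset_span h1)
  have hmono : ∀ {m n : ℕ}, m ≤ n → M ^ m ≤ M ^ n := fun h => pow_le_pow_right' hone h
  induction k with
  | zero =>
    refine le_trans ?_ le_sup_left
    rw [pow_zero, Submodule.one_le]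
    exact Submodule.subset_span ⟨i₀, ∅, by simp [hδ], by simp [hi₀]⟩
  | succ k ih =>
    rw [pow_succ]
    refine (mul_le_mul_left ih M).trans ?_
    rw [Submodule.sup_mul, mul_assoc, ← pow_succ]
    refine sup_le ?_ le_sup_right
    rw [hM, Submodule.span_mul_span, Submodule.span_le, ← hM]
    rintro _ ⟨_, ⟨i, b, hib, rfl⟩, x, hx, rfl⟩
    set w := ∏ j ∈ b, u j with hw
    have hwb : ∀ c : Finset (Fin 3), ∏ j ∈ c, u j ∈ M ^ c.card := by
      intro c
      induction c using Finset.induction_on with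
      | empty => simp [Submodule.one_le.1 le_rfl]
      | insert j c hj ihc =>
        rw [Finset.prod_insert hj, Finset.card_insert_of_notMem hj, mul_comm, pow_succ]
        exact Submodule.mul_mem_mul ihc (hu j)
    change γ i * w * x ∈ _
    rw [mul_right_comm]
    refine Submodule.span_induction (p := fun y _ => y * w ∈
      Submodule.span ℤ {y | ∃ i, ∃ b : Finset (Fin 3),
        δ i + b.card ≤ k + 1 ∧ y = γ i * ∏ j ∈ b, u j} ⊔
        Submodule.span ℤ {(2 : R)} * M ^ (k + 1)) ?_ ?_ ?_ ?_ (hmul x hx i)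
    · rintro y (⟨i', hi', rfl⟩ | ⟨i', j, hi', rfl⟩)
      · exact Submodule.mem_sup_left (Submodule.subset_span ⟨i', b, by omega, rfl⟩)
      · by_cases hj : j ∈ b
        · refine Submodule.mem_sup_right (Submodule.mem_span_singleton_mul.2 ?_)
          obtain ⟨z, hz, hjz⟩ := hsq j
          refine ⟨z * (γ i' * ∏ l ∈ b.erase j, u l), ?_, ?_⟩
          · have hc := Finset.card_erase_add_one hj
            have : M ^ (2 + (δ i' + (b.erase j).card)) ≤ M ^ (k + 1) := hmono (by omega)
            refine this ?_
            rw [pow_add, pow_add]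
            exact Submodule.mul_mem_mul hz (Submodule.mul_mem_mul (hγ i') (hwb _))
          · rw [← mul_assoc, ← hjz, hw, ← Finset.mul_prod_erase b u hj]
            ring
        · refine Submodule.mem_sup_left (Submodule.subset_span ⟨i', insert j b, ?_, ?_⟩)
          · rw [Finset.card_insert_of_notMem hj]
            omega
          · rw [Finset.prod_insert hj, mul_assoc]
    · simp
    · intro y z _ _ hy hz
      rw [add_mul]
      exact add_mem hy hz
    · intro n y _ hy
      rw [smul_mul_assoc]
      exact Submodule.smul_mem _ _ hy

/-- Nakayama's lemma at the prime `2` removes the error term of `pow_le_span_sup_two_mul`, after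
extension of scalars to `ℂ`. -/
lemma exists_pow_le_span [Algebra ℂ R] {ι : Type*} (X : Set R) (hX : X.Finite)
    (h1 : (1 : R) ∈ X) (u : Fin 3 → R) (hu : ∀ j, u j ∈ Submodule.span ℤ X)
    (hsq : ∀ j, ∃ z ∈ Submodule.span ℤ X ^ 2, u j ^ 2 = 2 * z) (γ : ι → R) (δ : ι → ℕ)
    (hγ : ∀ i, γ i ∈ Submodule.span ℤ X ^ δ i) (i₀ : ι) (hi₀ : γ i₀ = 1) (hδ : δ i₀ = 0)
    (hmul : ∀ x ∈ X, ∀ i, γ i * x ∈ Submodule.span ℤ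
      ({y | ∃ i', δ i' ≤ δ i + 1 ∧ y = γ i'} ∪ {y | ∃ i' j, δ i' ≤ δ i ∧ y = γ i' * u j})) (k : ℕ) :
    Submodule.span ℂ X ^ k ≤
      Submodule.span ℂ (Set.range fun p : ι × Finset (Fin 3) => γ p.1 * ∏ j ∈ p.2, u j) := by
  set W := Submodule.span ℤ {y | ∃ i, ∃ b : Finset (Fin 3), δ i + b.card ≤ k ∧
    y = γ i * ∏ j ∈ b, u j} with hW
  have hle := pow_le_span_sup_two_mul X h1 u hu hsq γ δ hγ i₀ hi₀ hδ hmul k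
  rw [← hW] at hle
  have hfg : (Submodule.span ℤ X ^ k).FG := Submodule.FG.pow (Submodule.fg_span hX) k
  obtain ⟨r, hr, hr0⟩ := Submodule.exists_sub_one_mem_and_smul_eq_zero_of_fg_of_le_smul
    (Ideal.span {(2 : ℤ)}) ((Submodule.span ℤ X ^ k).map W.mkQ) (hfg.map _) (by
      rintro _ ⟨x, hx, rfl⟩
      obtain ⟨w, hw, _, hz', rfl⟩ := Submodule.mem_sup.1 (hle hx)
      obtain ⟨z, hz, rfl⟩ := Submodule.mem_span_singleton_mul.1 hz'
      have hw0 : W.mkQ w = 0 := (Submodule.Quotient.mk_eq_zero W).2 hw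
      rw [map_add, hw0, zero_add]
      have : W.mkQ (2 * z) = (2 : ℤ) • W.mkQ z := by
        rw [← map_smul]
        congr 1
        simp
      rw [this]
      exact Submodule.smul_mem_smul (Ideal.mem_span_singleton_self 2)
        (Submodule.mem_map_of_mem hz))
  have hr1 : (r : ℂ) ≠ 0 := by
    obtain ⟨q, hq⟩ := Ideal.mem_span_singleton.1 hr
    have : r ≠ 0 := by omega
    exact_mod_cast this
  rw [Submodule.span_pow, Submodule.span_le]
  intro x hx
  have hx' : x ∈ Submodule.span ℤ X ^ k := by
    rw [Submodule.span_pow]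
    exact Submodule.subset_span hx
  have hrx : r • x ∈ W := by
    have := hr0 _ (Submodule.mem_map_of_mem hx')
    rw [← map_smul] at this
    exact (Submodule.Quotient.mk_eq_zero W).1 this
  have hWle : ∀ y ∈ W, y ∈ Submodule.span ℂ
      (Set.range fun p : ι × Finset (Fin 3) => γ p.1 * ∏ j ∈ p.2, u j) := by
    intro y hy
    refine Submodule.span_induction ?_ (zero_mem _) (fun _ _ _ _ => add_mem)
      (fun n _ _ h => zsmul_mem h n) hy
    rintro _ ⟨i, b, -, rfl⟩
    exact Submodule.subset_span ⟨(i, b), rfl⟩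
  have := Submodule.smul_mem _ ((r : ℂ)⁻¹) (hWle _ hrx)
  rwa [← Int.cast_smul_eq_zsmul ℂ, smul_smul, inv_mul_cancel₀ hr1, one_smul] at this

/-- A finite set of points on which all polynomial functions are spanned by `m` of them has at most
`m` elements. -/
lemma card_le_of_pow_le_span {E κ : Type*} [Fintype κ] (S : Finset (E → ℂ)) (X : Set (S → ℂ))
    (h1 : (1 : S → ℂ) ∈ X) (hX : ∀ e, (fun s : S => (s : E → ℂ) e) ∈ Submodule.span ℂ X)
    (w : κ → S → ℂ) (h : ∀ k, Submodule.span ℂ X ^ k ≤ Submodule.span ℂ (Set.range w)) :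
    S.card ≤ Fintype.card κ := by
  classical
  have htop : Submodule.span ℂ (Set.range w) = ⊤ := by
    rw [eq_top_iff, ← (Pi.basisFun ℂ S).span_eq, Submodule.span_le]
    rintro _ ⟨s, rfl⟩
    have hsep : ∀ t : S, ∃ f ∈ Submodule.span ℂ X, f s = 1 ∧ (t ≠ s → f t = 0) := by
      intro t
      by_cases hts : t = s
      · exact ⟨1, Submodule.subset_span h1, rfl, fun h => absurd hts h⟩
      · obtain ⟨e, he⟩ : ∃ e, (t : E → ℂ) e ≠ (s : E → ℂ) e := by
          by_contra! hc
          exact hts (Subtype.ext (funext hc))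
        have hne : (s : E → ℂ) e - (t : E → ℂ) e ≠ 0 := sub_ne_zero.2 he.symm
        refine ⟨((s : E → ℂ) e - (t : E → ℂ) e)⁻¹ •
          ((fun s : S => (s : E → ℂ) e) - (t : E → ℂ) e • (1 : S → ℂ)), ?_, ?_, fun _ => ?_⟩
        · exact Submodule.smul_mem _ _ (sub_mem (hX e)
            (Submodule.smul_mem _ _ (Submodule.subset_span h1)))
        · simp [hne]
        · simp
    choose f hf hfs hft using hsep
    have hprod : ∀ T : Finset S, ∏ t ∈ T, f t ∈ Submodule.span ℂ X ^ T.card := by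
      intro T
      induction T using Finset.induction_on with
      | empty => simp [Submodule.one_le.1 le_rfl]
      | insert j c hj ihc =>
        rw [Finset.prod_insert hj, Finset.card_insert_of_notMem hj, mul_comm, pow_succ]
        exact Submodule.mul_mem_mul ihc (hf j)
    have he : Pi.basisFun ℂ S s = ∏ t, f t := by
      ext t
      rw [Pi.basisFun_apply, Finset.prod_apply]
      by_cases hts : t = s
      · subst hts
        simp [hfs]
      · rw [Finset.prod_eq_zero (f := fun c => f c t) (Finset.mem_univ t) (hft t hts)]
        simp [hts]
    rw [he]
    exact h _ (hprod _)
  have := finrank_range_le_card (R := ℂ) w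
  rw [Set.finrank, htop, finrank_top, Module.finrank_fintype_fun_eq_card, Fintype.card_coe] at this
  exact this

end UpperBound

/-- The off-diagonal positions of a symmetric `4 × 4` matrix. -/
def edge : Fin 6 → Fin 4 × Fin 4 := ![(0, 1), (0, 2), (0, 3), (1, 2), (1, 3), (2, 3)]

/-- The polarisation of the pair `a`, `b` at an off-diagonal position. -/
def polar (a b : Fin 4 → ℤ) (e : Fin 6) : ℤ :=
  a (edge e).1 * b (edge e).2 + a (edge e).2 * b (edge e).1

/-- The term by which a nonzero last diagonal entry modifies `tangency`; the weights `ε` select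
the nonzero entries among those at `(0, 1)`, `(0, 2)`, `(1, 2)`. -/
def correction (ε : Fin 3 → ℤ) (a b : Fin 4 → ℤ) (k l : Fin 6) : ℤ :=
  if k = 2 ∧ l = 4 then ε 0 * ((a 0 * b 3 - a 3 * b 0) * (a 1 * b 3 - a 3 * b 1))
  else if k = 2 ∧ l = 5 then ε 1 * ((a 0 * b 3 - a 3 * b 0) * (a 2 * b 3 - a 3 * b 2))
  else if k = 4 ∧ l = 5 then ε 2 * ((a 1 * b 3 - a 3 * b 1) * (a 2 * b 3 - a 3 * b 2))
  else 0

/-- The quadratic form in the off-diagonal entries of a quadric expressing its tangency to the line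
through `a` and `b`. -/
def tangency (ε : Fin 3 → ℤ) (a b : Fin 4 → ℤ) (k l : Fin 6) : ℤ :=
  polar a a k * polar b b l - polar a b k * polar a b l + 4 * correction ε a b k l

section Tangency

variable {R : Type*} [CommRing R]

lemma quadEval_tangency (ε : Fin 3 → ℤ) (a b : Fin 4 → ℤ) (y : Fin 6 → R) :
    quadEval (tangency ε a b) y =
      (∑ e, (polar a a e : R) * y e) * (∑ e, (polar b b e : R) * y e) -
        (∑ e, (polar a b e : R) * y e) ^ 2 + 4 * quadEval (correction ε a b) y := by
  rw [sq, Finset.sum_mul_sum, Finset.sum_mul_sum]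
  simp only [quadEval, tangency, Finset.mul_sum, ← Finset.sum_sub_distrib,
    ← Finset.sum_add_distrib]
  refine Finset.sum_congr rfl fun k _ => Finset.sum_congr rfl fun l _ => ?_
  push_cast
  ring

lemma quadEval_correction (ε : Fin 3 → ℤ) (a b : Fin 4 → ℤ) (y : Fin 6 → R) :
    quadEval (correction ε a b) y =
      ε 0 * ((a 0 * b 3 - a 3 * b 0) * (a 1 * b 3 - a 3 * b 1)) * y 2 * y 4 +
      ε 1 * ((a 0 * b 3 - a 3 * b 0) * (a 2 * b 3 - a 3 * b 2)) * y 2 * y 5 +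
      ε 2 * ((a 1 * b 3 - a 3 * b 1) * (a 2 * b 3 - a 3 * b 2)) * y 4 * y 5 := by
  simp [quadEval, correction, Fin.sum_univ_six]

lemma quadEval_apply {ι κ : Type*} [Fintype ι] (G : ι → ι → ℤ) (y : ι → κ → R) (s : κ) :
    quadEval G y s = quadEval G fun k => y k s := by
  simp [quadEval, Finset.sum_apply]

/-- A tangency condition to an integral line makes the square of a linear form divisible by `2`. -/
lemma sq_eq_two_mul_of_tangency (M : Submodule ℤ R) (ε : Fin 3 → ℤ) (a b : Fin 4 → ℤ)
    (y : Fin 6 → R) (hy : ∀ e, y e ∈ M) (h : quadEval (tangency ε a b) y = 0) (c : Fin 6 → ℤ)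
    (hc : ∀ e, (2 : ℤ) ∣ polar a b e - c e) :
    ∃ z ∈ M ^ 2, (∑ e, (c e : R) * y e) ^ 2 = 2 * z := by
  choose d hd using hc
  have hlin : ∀ f : Fin 6 → ℤ, ∑ e, (f e : R) * y e ∈ M := fun f =>
    sum_mem fun e _ => by
      rw [← zsmul_eq_mul]
      exact zsmul_mem (hy e) _
  have hmul : ∀ p ∈ M, ∀ q ∈ M, p * q ∈ M ^ 2 := fun p hp q hq => by
    rw [sq]
    exact Submodule.mul_mem_mul hp hq
  have hquad : ∀ G : Fin 6 → Fin 6 → ℤ, quadEval G y ∈ M ^ 2 := fun G =>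
    sum_mem fun k _ => sum_mem fun l _ => by
      rw [mul_assoc, ← zsmul_eq_mul]
      exact zsmul_mem (hmul _ (hy k) _ (hy l)) _
  have hpol : ∀ p : Fin 4 → ℤ, ∃ q ∈ M, ∑ e, (polar p p e : R) * y e = 2 * q := fun p => by
    refine ⟨∑ e, ((p (edge e).1 * p (edge e).2 : ℤ) : R) * y e, hlin _, ?_⟩
    rw [Finset.mul_sum]
    refine Finset.sum_congr rfl fun e _ => ?_
    simp only [polar]
    push_cast
    ring
  obtain ⟨A, hA, hA'⟩ := hpol a
  obtain ⟨B, hB, hB'⟩ := hpol b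
  set u := ∑ e, (c e : R) * y e with hu
  set w := ∑ e, (d e : R) * y e with hw
  have hC : ∑ e, (polar a b e : R) * y e = u + 2 * w := by
    rw [hu, hw, Finset.mul_sum, ← Finset.sum_add_distrib]
    refine Finset.sum_congr rfl fun e _ => ?_
    have := congrArg (Int.cast : ℤ → R) (hd e)
    push_cast at this
    linear_combination y e * this
  rw [quadEval_tangency, hA', hB', hC] at h
  refine ⟨2 • (A * B + quadEval (correction ε a b) y - u * w - w * w), ?_, ?_⟩
  · exact nsmul_mem (sub_mem (sub_mem (add_mem (hmul _ hA _ hB) (hquad _))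
      (hmul _ (hlin _) _ (hlin _))) (hmul _ (hlin _) _ (hlin _))) _
  · rw [nsmul_eq_mul]
    push_cast
    linear_combination -h

end Tangency

section Counting

/-- The parities of the Plücker coordinates of three lines. -/
def parity : Fin 3 → Fin 6 → ℤ :=
  ![![0, 0, 0, 1, 0, 1], ![0, 1, 1, 1, 1, 1], ![1, 1, 0, 1, 0, 0]]

lemma card_le_eight (ε : Fin 3 → ℤ) (a b : Fin 3 → Fin 4 → ℤ)
    (hpar : ∀ j e, (2 : ℤ) ∣ polar (a j) (b j) e - parity j e) (S : Finset (Fin 6 → ℂ))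
    (hS : ∀ s ∈ S, ∀ j, quadEval (tangency ε (a j) (b j)) s = 0) (β : Fin 6 → Fin 4 → ℤ)
    (hβ : ∀ s ∈ S, ∀ e, s e = β e 0 + ∑ j : Fin 3, β e j.succ * ∑ f, (parity j f : ℂ) * s f) :
    S.card ≤ 8 := by
  set y : Fin 6 → S → ℂ := fun e s => (s : Fin 6 → ℂ) e with hy
  set u : Fin 3 → S → ℂ := fun j => ∑ e, (parity j e : S → ℂ) * y e with hu
  set X : Set (S → ℂ) := insert 1 (Set.range u) with hX
  have h1 : (1 : S → ℂ) ∈ X := Set.mem_insert _ _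
  have huX : ∀ j, u j ∈ Submodule.span ℤ X := fun j =>
    Submodule.subset_span (Set.mem_insert_of_mem _ ⟨j, rfl⟩)
  have hyX : ∀ e, y e ∈ Submodule.span ℤ X := by
    intro e
    have : y e = β e 0 • (1 : S → ℂ) + ∑ j : Fin 3, β e j.succ • u j := by
      ext s
      simp [hu, hy, hβ s s.2 e, Finset.sum_apply]
    rw [this]
    exact add_mem (zsmul_mem (Submodule.subset_span h1) _)
      (sum_mem fun j _ => zsmul_mem (huX j) _)
  have key := exists_pow_le_span X (Set.finite_range u |>.insert 1) h1 u huX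
    (fun j => sq_eq_two_mul_of_tangency _ ε (a j) (b j) y hyX
      (by ext s; rw [quadEval_apply]; exact hS s s.2 j) _ (hpar j))
    (fun _ : Unit => 1) (fun _ => 0) (fun _ => by simp [Submodule.one_le.1 le_rfl]) () rfl rfl
    (by
      rintro x (rfl | ⟨j, rfl⟩) -
      · exact Submodule.subset_span (Or.inl ⟨(), by simp⟩)
      · exact Submodule.subset_span (Or.inr ⟨(), j, le_rfl, rfl⟩))
  have := card_le_of_pow_le_span S X h1 (fun e => ?_) _ key
  · simpa using this
  · exact Submodule.span_subset_span ℤ ℂ X (hyX e)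

lemma card_le_thirty_two (ε : Fin 3 → ℤ) (a b : Fin 3 → Fin 4 → ℤ)
    (hpar : ∀ j e, (2 : ℤ) ∣ polar (a j) (b j) e - parity j e) (S : Finset (Fin 6 → ℂ))
    (hS : ∀ s ∈ S, ∀ j, quadEval (tangency ε (a j) (b j)) s = 0) (h2 : ∀ s ∈ S, s 2 = 1)
    (h05 : ∀ s ∈ S, s 0 * s 5 = s 3) (h14 : ∀ s ∈ S, s 1 * s 4 = s 3) :
    S.card ≤ 32 := by
  set y : Fin 6 → S → ℂ := fun e s => (s : Fin 6 → ℂ) e with hy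
  set u : Fin 3 → S → ℂ := ![y 3 + y 5, y 1 + 1 + y 4, y 0 + y 1 + y 3] with hu
  have hy2 : y 2 = 1 := by ext s; exact h2 s s.2
  have hy05 : y 0 * y 5 = y 3 := by ext s; exact h05 s s.2
  have hy14 : y 1 * y 4 = y 3 := by ext s; exact h14 s s.2
  set X : Set (S → ℂ) := {1, y 0, y 1} ∪ Set.range u with hX
  have h1 : (1 : S → ℂ) ∈ X := Or.inl (by simp)
  have huX : ∀ j, u j ∈ Submodule.span ℤ X := fun j =>
    Submodule.subset_span (Or.inr ⟨j, rfl⟩)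
  have h1X : (1 : S → ℂ) ∈ Submodule.span ℤ X := Submodule.subset_span h1
  have hy0X : y 0 ∈ Submodule.span ℤ X := Submodule.subset_span (Or.inl (by simp))
  have hy1X : y 1 ∈ Submodule.span ℤ X := Submodule.subset_span (Or.inl (by simp))
  have hy3 : y 3 = u 2 - y 0 - y 1 := by simp [hu]; ring
  have hy4 : y 4 = u 1 - 1 - y 1 := by simp [hu]; ring
  have hy5 : y 5 = u 0 - u 2 + y 0 + y 1 := by simp [hu]; ring
  have hy3X : y 3 ∈ Submodule.span ℤ X := hy3 ▸ sub_mem (sub_mem (huX 2) hy0X) hy1X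
  have hyX : ∀ e, y e ∈ Submodule.span ℤ X := by
    intro e
    fin_cases e
    · exact hy0X
    · exact hy1X
    · exact hy2 ▸ h1X
    · exact hy3X
    · exact hy4 ▸ sub_mem (sub_mem (huX 1) h1X) hy1X
    · exact hy5 ▸ add_mem (add_mem (sub_mem (huX 0) (huX 2)) hy0X) hy1X
  have hsq : ∀ j, ∃ z ∈ Submodule.span ℤ X ^ 2,
      (∑ e, (parity j e : S → ℂ) * y e) ^ 2 = 2 * z := fun j =>
    sq_eq_two_mul_of_tangency _ ε (a j) (b j) y hyX
      (by ext s; rw [quadEval_apply]; exact hS s s.2 j) _ (hpar j)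
  have hmul : ∀ p ∈ Submodule.span ℤ X, ∀ q ∈ Submodule.span ℤ X,
      p * q ∈ Submodule.span ℤ X ^ 2 := fun p hp q hq => by
    rw [sq]
    exact Submodule.mul_mem_mul hp hq
  have ha2 : y 0 * y 0 = u 2 - y 0 - y 1 - y 0 * u 0 + y 0 * u 2 - y 0 * y 1 := by
    rw [hy5, hy3] at hy05
    linear_combination hy05
  have hc2 : y 1 * y 1 = y 1 * u 1 - u 2 + y 0 := by
    rw [hy4, hy3] at hy14
    linear_combination -hy14
  have hc : y 0 * y 1 * y 1 = u 2 - y 0 - y 1 - y 0 * u 0 - y 0 * y 1 + y 0 * y 1 * u 1 := by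
    linear_combination y 0 * hc2 + ha2
  have ha : y 0 * y 1 * y 0 = y 1 + y 1 * u 2 - y 1 * u 1 + y 0 * u 0 +
      (y 0 * y 1 * u 2 - y 0 * y 1 * u 0 - y 0 * y 1 * u 1) := by
    linear_combination y 1 * ha2 - hc2 - hc
  set γ : Fin 4 → S → ℂ := ![1, y 0, y 1, y 0 * y 1] with hγ
  set δ : Fin 4 → ℕ := ![0, 1, 1, 2] with hδ
  have key := exists_pow_le_span X (Set.toFinite _) h1 u huX
    (fun j => by
      obtain ⟨z₀, hz₀, e₀⟩ := hsq 0
      obtain ⟨z₁, hz₁, e₁⟩ := hsq 1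
      obtain ⟨z₂, hz₂, e₂⟩ := hsq 2
      simp [Fin.sum_univ_six, parity, hy2] at e₀ e₁ e₂
      fin_cases j
      · exact ⟨z₀, hz₀, by simpa [hu] using e₀⟩
      · refine ⟨z₁ + z₀ - (y 3 + y 5) * (y 1 + 1 + y 3 + y 4 + y 5), sub_mem (add_mem hz₁ hz₀)
          (hmul _ (add_mem (hyX 3) (hyX 5)) _ (add_mem (add_mem (add_mem (add_mem hy1X h1X) hy3X)
            (hyX 4)) (hyX 5))), ?_⟩
        simp [hu]
        linear_combination e₀ + e₁
      · exact ⟨z₂, hz₂, by simpa [hu] using e₂⟩)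
    γ δ (fun i => by
      fin_cases i
      · simp [hγ, hδ, Submodule.one_le.1 le_rfl]
      · simpa [hγ, hδ] using hy0X
      · simpa [hγ, hδ] using hy1X
      · exact hmul _ hy0X _ hy1X) 0 rfl rfl
    (by
      intro x hx i
      set T := Submodule.span ℤ ({z | ∃ i', δ i' ≤ δ i + 1 ∧ z = γ i'} ∪
        {z | ∃ i' j, δ i' ≤ δ i ∧ z = γ i' * u j}) with hT
      have m1 : ∀ i', δ i' ≤ δ i + 1 → γ i' ∈ T := fun i' h =>
        Submodule.subset_span (Or.inl ⟨i', h, rfl⟩)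
      have m2 : ∀ i' j, δ i' ≤ δ i → γ i' * u j ∈ T := fun i' j h =>
        Submodule.subset_span (Or.inr ⟨i', j, h, rfl⟩)
      obtain (rfl | rfl | rfl) | ⟨j, rfl⟩ := hx
      · rw [mul_one]
        exact m1 i (by omega)
      · have n0 : δ 0 ≤ δ i := Nat.zero_le _
        have n1 : (1 : S → ℂ) * u 2 ∈ T := m2 0 2 n0
        rw [one_mul] at n1
        fin_cases i
        · exact (one_mul (y 0)).symm ▸ m1 1 le_rfl
        · change y 0 * y 0 ∈ T
          rw [ha2]
          exact sub_mem (add_mem (sub_mem (sub_mem (sub_mem n1 (m1 1 (by decide)))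
            (m1 2 (by decide))) (m2 1 0 le_rfl)) (m2 1 2 le_rfl)) (m1 3 le_rfl)
        · change y 1 * y 0 ∈ T
          rw [mul_comm]
          exact m1 3 le_rfl
        · change y 0 * y 1 * y 0 ∈ T
          rw [ha]
          exact add_mem (add_mem (sub_mem (add_mem (m1 2 (by decide)) (m2 2 2 (by decide)))
            (m2 2 1 (by decide))) (m2 1 0 (by decide)))
            (sub_mem (sub_mem (m2 3 2 le_rfl) (m2 3 0 le_rfl)) (m2 3 1 le_rfl))
      · have n0 : δ 0 ≤ δ i := Nat.zero_le _
        have n1 : (1 : S → ℂ) * u 2 ∈ T := m2 0 2 n0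
        rw [one_mul] at n1
        fin_cases i
        · exact (one_mul (y 1)).symm ▸ m1 2 le_rfl
        · exact m1 3 le_rfl
        · change y 1 * y 1 ∈ T
          rw [hc2]
          exact add_mem (sub_mem (m2 2 1 le_rfl) n1) (m1 1 (by decide))
        · change y 0 * y 1 * y 1 ∈ T
          rw [hc]
          exact add_mem (sub_mem (sub_mem (sub_mem (sub_mem n1 (m1 1 (by decide)))
            (m1 2 (by decide))) (m2 1 0 (by decide))) (m1 3 (by decide))) (m2 3 1 le_rfl)
      · exact m2 i j le_rfl)
  have := card_le_of_pow_le_span S X h1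
    (fun e => Submodule.span_subset_span ℤ ℂ X (hyX e)) _ key
  simpa using this

end Counting

/-- First spanning points of the three lines. -/
def lineStart : Fin 3 → Fin 4 → ℤ := ![![8, 0, -1, -2], ![1, -5, 1, -6], ![5, 4, -5, 0]]

/-- Second spanning points of the three lines. -/
def lineEnd : Fin 3 → Fin 4 → ℤ := ![![-2, 3, -9, 1], ![1, 5, -4, -3], ![3, -5, 0, -6]]

lemma two_dvd_polar_sub_parity :
    ∀ j e, (2 : ℤ) ∣ polar (lineStart j) (lineEnd j) e - parity j e := by decide

/-- The coefficients relating the last diagonal entry to the entries at `(0, 1)`, `(0, 2)`, `(1, 2)`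
on each stratum. -/
def weight : Fin 10 → Fin 3 → ℤ :=
  ![![1, 1, 1], ![1, 0, 0], ![0, 1, 0], ![0, 0, 1], ![0, 0, 0], ![0, 0, 0], ![0, 0, 0], ![0, 0, 0],
    ![0, 0, 0], ![0, 0, 0]]

/-- The position normalised to `1` on each stratum. -/
def base : Fin 10 → Fin 6 := ![2, 2, 2, 2, 2, 5, 4, 2, 4, 5]

/-- The positions of the nonzero off-diagonal entries on each stratum. -/
def support : Fin 10 → Finset (Fin 6) :=
  ![Finset.univ, {0, 2, 4, 5}, {1, 2, 4, 5}, {2, 3, 4, 5}, {1, 2, 3, 4}, {0, 2, 3, 5},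
    {0, 1, 4, 5}, {0, 1, 2, 3}, {0, 1, 3, 4}, {0, 1, 3, 5}]

/-- Coordinates on the small strata. -/
def chart : Fin 9 → Fin 4 → Fin 6 :=
  ![![2, 0, 4, 5], ![2, 1, 4, 5], ![2, 3, 4, 5], ![2, 1, 3, 4], ![5, 0, 2, 3], ![4, 0, 1, 5],
    ![2, 0, 1, 3], ![4, 0, 1, 3], ![5, 0, 1, 3]]

/-- Coordinates on the large stratum. -/
def largeChart : Fin 6 → Fin 6 := ![2, 0, 1, 3, 4, 5]

/-- Integral expressions of the entries in terms of the linear forms given by `parity`. -/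
def entryCoeff : Fin 9 → Fin 6 → Fin 4 → ℤ :=
  ![![![0, 0, 0, 1], ![0, 0, 0, 0], ![1, 0, 0, 0], ![0, 0, 0, 0], ![-1, -1, 1, 0], ![0, 1, 0,
    0]],
    ![![0, 0, 0, 0], ![0, 0, 0, 1], ![1, 0, 0, 0], ![0, 0, 0, 0], ![-1, -1, 1, -1], ![0, 1, 0,
    0]],
    ![![0, 0, 0, 0], ![0, 0, 0, 0], ![1, 0, 0, 0], ![0, 0, 0, 1], ![-1, -1, 1, 0], ![0, 1, 0,
    -1]],
    ![![0, 0, 0, 0], ![0, -1, 0, 1], ![1, 0, 0, 0], ![0, 1, 0, 0], ![-1, 0, 1, -1], ![0, 0, 0,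
    0]],
    ![![1, -1, 0, 1], ![0, 0, 0, 0], ![0, -1, 1, 0], ![-1, 1, 0, 0], ![0, 0, 0, 0], ![1, 0, 0,
    0]],
    ![![1, 1, -1, 1], ![-1, -1, 1, 0], ![0, 0, 0, 0], ![0, 0, 0, 0], ![1, 0, 0, 0], ![0, 1, 0,
    0]],
    ![![1, 0, -1, 1], ![-1, -1, 1, 0], ![1, 0, 0, 0], ![0, 1, 0, 0], ![0, 0, 0, 0], ![0, 0, 0,
    0]],
    ![![1, 0, -1, 1], ![-1, -1, 1, 0], ![0, 0, 0, 0], ![0, 1, 0, 0], ![1, 0, 0, 0], ![0, 0, 0,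
    0]],
    ![![1, 0, -1, 1], ![0, -1, 1, 0], ![0, 0, 0, 0], ![-1, 1, 0, 0], ![0, 0, 0, 0], ![1, 0, 0,
    0]]]

/-- The tangency conditions in the coordinates `chart`. -/
def smallForm : Fin 9 → Fin 3 → Fin 4 → Fin 4 → ℤ :=
  ![![![![-16, 96, -24, 372], ![-288, -576, 144, -408], ![72, 144, -36, 102], ![-220, -456,
    126, -361]], ![![-9, -120, 765, -99], ![60, -100, 300, -240], ![-495, 600, -2025, 1755],
    ![261, -120, 675, -729]], ![![-900, -390, 2160, 900], ![-1830, -1369, 2088, 390], ![-720,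
    -312, -576, 720], ![900, 390, 720, -900]]],
    ![![![-16, -312, -120, 68], ![904, -5476, -516, 1478], ![72, -420, -36, 102], ![-220, 1334,
    126, -361]], ![![-9, 69, 225, -423], ![-39, -25, -105, 111], ![-495, -525, -2025, 1755],
    ![261, 159, 675, -729]], ![![-900, -450, -720, -2700], ![1350, -225, -3360, 450], ![-720,
    -360, -576, 720], ![900, 450, 720, -900]]],
    ![![![-16, 1764, -120, 372], ![36, -9, -18, 51], ![72, -18, -36, -354], ![-220, -165, 126,
    -361]], ![![-9, 705, 225, -99], ![285, -225, 675, -765], ![-495, -2025, -2025, -3105],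
    ![261, -45, 675, -729]], ![![-900, 750, -720, 900], ![2190, -625, -1800, -750], ![-720,
    600, -576, -2160], ![900, -750, 720, -900]]],
    ![![![-16, -312, 1764, -120], ![904, -5476, 654, -516], ![36, -210, -9, -18], ![72, -420,
    -18, -36]], ![![-9, 69, 705, 225], ![-39, -25, -5, -105], ![285, 155, -225, 675], ![-495,
    -525, -2025, -2025]], ![![-900, -450, 750, -720], ![1350, -225, 375, -3360], ![2190, 375,
    -625, -1800], ![-720, -360, 600, -576]]],
    ![![![-361, -456, -220, -165], ![-408, -576, -288, 72], ![372, 96, -16, 1764], ![51, 72,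
    36, -9]], ![![-729, -120, 261, -45], ![-240, -100, 60, 400], ![-99, -120, -9, 705], ![-765,
    -100, 285, -225]], ![![-900, 390, 900, -750], ![390, -1369, -1830, 325], ![900, -390, -900,
    750], ![-750, 1525, 2190, -625]]],
    ![![![-36, 144, -420, 102], ![144, -576, 1680, -408], ![-516, 1872, -5476, 1478], ![126,
    -456, 1334, -361]], ![![-2025, 600, -525, 1755], ![300, -100, 80, -240], ![-105, 20, -25,
    111], ![675, -120, 159, -729]], ![![-576, -312, -360, 720], ![2088, -1369, -195, 390],
    ![-3360, 1305, -225, 450], ![720, 390, 450, -900]]],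
    ![![![-16, 96, -312, 1764], ![-288, -576, 1680, 72], ![904, 1872, -5476, 654], ![36, 72,
    -210, -9]], ![![-9, -120, 69, 705], ![60, -100, 80, 400], ![-39, 20, -25, -5], ![285, -100,
    155, -225]], ![![-900, -390, -450, 750], ![-1830, -1369, -195, 325], ![1350, 1305, -225,
    375], ![2190, 1525, 375, -625]]],
    ![![![-36, 144, -420, -18], ![144, -576, 1680, 72], ![-516, 1872, -5476, 654], ![-18, 72,
    -210, -9]], ![![-2025, 600, -525, -2025], ![300, -100, 80, 400], ![-105, 20, -25, -5],
    ![675, -100, 155, -225]], ![![-576, -312, -360, 600], ![2088, -1369, -195, 325], ![-3360,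
    1305, -225, 375], ![-1800, 1525, 375, -625]]],
    ![![![-361, -456, 1334, -165], ![-408, -576, 1680, 72], ![1478, 1872, -5476, 654], ![51,
    72, -210, -9]], ![![-729, -120, 159, -45], ![-240, -100, 80, 400], ![111, 20, -25, -5],
    ![-765, -100, 155, -225]], ![![-900, 390, 450, -750], ![390, -1369, -195, 325], ![450,
    1305, -225, 375], ![-750, 1525, 375, -625]]]]

/-- The tangency and toric conditions in the coordinates `largeChart`. -/
def largeForm : Fin 5 → Fin 6 → Fin 6 → ℤ :=
  ![![![-16, 96, -312, 1764, -24, 68], ![-288, -576, 1680, 72, 144, -408], ![904, 1872, -5476,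
    654, -516, 1478], ![36, 72, -210, -9, -18, 51], ![72, 144, -420, -18, -36, -354], ![-220,
    -456, 1334, -165, 126, -361]],
    ![![-9, -120, 69, 705, 765, -423], ![60, -100, 80, 400, 300, -240], ![-39, 20, -25, -5,
    -105, 111], ![285, -100, 155, -225, 675, -765], ![-495, 600, -525, -2025, -2025, -3105],
    ![261, -120, 159, -45, 675, -729]],
    ![![-900, -390, -450, 750, 2160, -2700], ![-1830, -1369, -195, 325, 2088, 390], ![1350,
    1305, -225, 375, -3360, 450], ![2190, 1525, 375, -625, -1800, -750], ![-720, -312, -360,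
    600, -576, -2160], ![900, 390, 450, -750, 720, -900]],
    ![![0, 0, 0, -1, 0, 0], ![0, 0, 0, 0, 0, 1], ![0, 0, 0, 0, 0, 0], ![0, 0, 0, 0, 0, 0], ![0,
    0, 0, 0, 0, 0], ![0, 0, 0, 0, 0, 0]],
    ![![0, 0, 0, -1, 0, 0], ![0, 0, 0, 0, 0, 0], ![0, 0, 0, 0, 1, 0], ![0, 0, 0, 0, 0, 0], ![0,
    0, 0, 0, 0, 0], ![0, 0, 0, 0, 0, 0]]]

/-- Approximate zeros of `smallForm`, scaled by `1000`. -/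
def smallCenter : Fin 9 → Fin 8 → Fin 3 → ℤ :=
  ![![![-1196, 438, 732], ![-1186, -4, 630], ![-1068, 2364, 3437], ![-844, 915, 2493], ![-547,
    -97, 131], ![-409, 131, 86], ![-31, 81, 504], ![112, 440, 242]],
    ![![-953, -3134, -4252], ![-890, -4195, -5789], ![-800, -1308, -3282], ![-670, -1597,
    -3855], ![-134, -111, -602], ![-61, -404, -254], ![-38, -98, -549], ![125, -316, -121]],
    ![![-18, -370, 236], ![12, -84, 521], ![1854, -1534, 3489], ![4124, 419, -5065], ![8591,
    4175, -8880], ![9593, -11485, 9411], ![14369, 4664, -11864], ![41799, -7302, -18491]],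
    ![![-6768, -63014, 28511], ![-934, 5843, -3326], ![-759, 2431, 215], ![-439, 768, 326],
    ![-223, 298, -505], ![214, 38, -285], ![475, 556, 277], ![2287, 9474, -572]],
    ![![-1858, 1567, -6], ![-1516, 3910, -166], ![-1444, 124, -4605], ![-399, 22, -827], ![395,
    -333, -1269], ![1049, -1012, -1052], ![1291, -1555, -855], ![3429, 1503, 3568]],
    ![![459, 360, 1317], ![619, 494, 1262], ![941, 630, 1988], ![1207, 629, 970], ![1212, 938,
    1996], ![1362, 504, 853], ![1896, 1192, 1981], ![1980, 902, 1957]],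
    ![![-20809, -3810, -16642], ![-7477, -3000, -3770], ![-1142, -449, 67], ![-1084, -145, 81],
    ![-794, -275, 18], ![-715, -105, 17], ![-599, 1173, 4302], ![1462, -749, 5480]],
    ![![-6290, -3167, -2512], ![-3967, -619, -3581], ![-1918, -140, -5282], ![-903, -1294,
    -6726], ![-836, -59, -3004], ![173, -204, -1978], ![5975, 2954, 3197], ![16977, 2471,
    14184]],
    ![![-1869, 156, -5681], ![-664, -498, -4127], ![-378, -14, -825], ![-313, 227, -842],
    ![-40, 239, -1358], ![-34, 141, -1413], ![10212, 5257, 4139], ![37352, 5761, 31493]]]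

/-- Approximate inverses of the Jacobians of `smallForm` at `smallCenter`. -/
def smallInverse : Fin 9 → Fin 8 → Fin 3 → Fin 3 → ℤ :=
  ![![![![-555, -631, 4397], ![11697, -14567, -1429], ![16198, -2536, -4253]], ![![1409, -1671,
    5972], ![6428, 15298, -2134], ![13973, 4634, -5652]], ![![-1044, 768, 1041], ![-10004,
    -7624, -599], ![-14107, -4216, -1744]], ![![-2691, -2129, 1936], ![-6358, 9091, -2015],
    ![-12621, 7264, -3899]], ![![17234, 14738, -7753], ![4432, 22219, -732], ![10283, -5432,
    4423]], ![![29985, -12716, -5149], ![17339, -22825, 2148], ![7981, 3639, 2907]],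
    ![![-15554, 4030, -1135], ![-6226, 6909, 1510], ![-12497, -7607, 5215]], ![![-28784, -2390,
    692], ![-17309, -8500, 3251], ![-9210, 4253, 3004]]],
    ![![![489, 129, 972], ![-15257, 4723, 2878], ![-22125, 1536, 4698]], ![![-1072, 251, 646],
    ![13307, 4989, 1796], ![19260, 2931, 3023]], ![![3542, -1070, 1651], ![-8564, -6773, 3655],
    ![-17056, -5326, 7260]], ![![-3827, -955, 1253], ![7978, -7210, 3136], ![15769, -7006,
    6142]], ![![25289, 2017, -2217], ![3834, -4991, -2511], ![14665, 10095, -7652]], ![![13753,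
    -1246, -1121], ![7363, 7465, -3842], ![11148, -5583, -4139]], ![![-25010, 4604, -1104],
    ![-3265, -4490, -2156], ![-13406, 12661, -6694]], ![![-13164, -3730, -80], ![-5396, 6286,
    -2956], ![-8255, -9307, -2639]]],
    ![![![5940, 140, -261], ![-765, 8437, -3163], ![-9899, 5588, 3403]], ![![5708, -1667, 523],
    ![4397, -6051, -1595], ![-3666, -9351, 5664]], ![![2423, 4076, -3246], ![1592, -4785,
    1854], ![-3510, 4322, -2740]], ![![-7149, 959, 4877], ![-1765, 2485, -533], ![8632, -1388,
    -3288]], ![![-3995, -9047, 15821], ![-1992, -2928, 2215], ![4910, 5761, -9218]], ![![2060,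
    -1957, -1802], ![110, 2596, 1271], ![-1601, -1239, -766]], ![![-3189, 9229, -13702],
    ![-1267, -856, -569], ![3487, -3925, 6378]], ![![-1799, -1733, -2210], ![-310, 1101, 520],
    ![1647, 232, 567]]],
    ![![![-302, -237, -65], ![-3903, -1566, -240], ![1811, 467, 159]], ![![198, 42, 365],
    ![6769, -2114, -5832], ![-3212, 2643, 2490]], ![![718, -521, 1380], ![2197, 4883, -10132],
    ![-229, -3204, 1409]], ![![2087, 1588, -2792], ![-840, -4570, 9498], ![-83, -4552, 606]],
    ![![4660, -1109, -2101], ![-4407, 1800, 4938], ![3136, 5113, -4346]], ![![-4556, 2637,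
    1476], ![1540, 2951, 874], ![-1734, 7688, -2173]], ![![-2050, -3953, 2561], ![297, -10753,
    6220], ![124, -5891, 1027]], ![![-755, 1552, -825], ![-1653, 9368, -5325], ![188, -2264,
    828]]],
    ![![![2639, -31032, 2026], ![-1680, 24727, 1563], ![3355, 7856, -1097]], ![![10038, -24816,
    -111], ![-12970, 43513, -4006], ![1366, 275, 13]], ![![-91, 19150, -9349], ![-1262, 195,
    -105], ![-5854, 40755, -14814]], ![![16415, -28703, 11809], ![-14926, 12476, -4333],
    ![1422, -5040, -6555]], ![![39245, -50300, -13724], ![-35212, 47134, 6776], ![17249,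
    -49253, 7639]], ![![-41535, 49250, 18796], ![48075, -39982, -36047], ![-9949, -13344,
    17408]], ![![-18963, 55966, -14099], ![17868, -90842, 36278], ![1077, 8223, -9906]],
    ![![-7749, 10485, 4653], ![107, 2780, -126], ![-8667, 10527, 7312]]],
    ![![![27844, 9535, 4776], ![25800, 6403, 126], ![-8938, 18248, -3934]], ![![-37135, 10948,
    9175], ![-27676, 9078, 2009], ![13621, 16452, -5799]], ![![9559, -16018, 9367], ![11614,
    -7832, 2523], ![328, -16785, 745]], ![![19177, 9780, -10131], ![-9586, 7022, -2379],
    ![-13064, 11076, 4138]], ![![-11785, -15225, 15518], ![-12349, -10427, 6173], ![-271,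
    -15562, 612]], ![![-9886, 8755, -6161], ![11462, 4376, -1369], ![8381, 9627, 2270]],
    ![![2974, -5504, -14133], ![-4958, -5673, -4930], ![-476, -11965, 1052]], ![![-749, -2272,
    -8410], ![5693, -2947, -2153], ![420, -11090, 916]]],
    ![![![4472, -20432, -2589], ![355, -2962, -332], ![4347, -17354, -2847]], ![![-3033,
    -15582, 207], ![5, -8854, 7], ![-2865, -5368, -998]], ![![1220, -22363, 25906], ![6803,
    -27664, 13387], ![320, 21432, -5510]], ![![-1358, -19088, 18919], ![-6849, 15969, 1544],
    ![-293, 23273, -5044]], ![![7083, 34884, -28638], ![15002, -8674, -13973], ![-70, 10021,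
    2471]], ![![-6963, 57695, -21023], ![-14961, 38140, -2634], ![50, 9051, 2050]], ![![218,
    -4507, 1781], ![-725, -5492, 1370], ![-88, -20716, 3556]], ![![-1639, -10606, 5436], ![370,
    -463, 632], ![-1401, -20340, 6322]]],
    ![![![939, -12825, 2564], ![1269, -6343, 1114], ![-331, -5646, 442]], ![![-2047, -19274,
    4719], ![-1564, -2872, 931], ![1232, -15995, 1177]], ![![1705, 21777, -5087], ![-858, 1668,
    -548], ![-1957, 45418, -5770]], ![![-598, 4488, -1272], ![1153, 4292, -983], ![1057, 18099,
    -2470]], ![![11471, -21079, -4101], ![-981, -1533, -540], ![11544, -44989, -111]],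
    ![![-8184, -2768, -1220], ![1828, -3552, -998], ![-8442, -17109, 1347]], ![![562, 11469,
    641], ![-580, 5646, 536], ![661, 4873, 1402]], ![![-3848, 18212, 3756], ![-266, 2695, 487],
    ![-3764, 15348, 3982]]],
    ![![![2961, 11711, -5988], ![-954, 835, -536], ![3488, 25031, -8640]], ![![-1471, 8448,
    -3431], ![1374, 8041, -2785], ![-2189, 33552, -8131]], ![![2336, -17330, 7830], ![9030,
    -8633, 2835], ![-468, -3072, -6971]], ![![-2600, -14539, 8463], ![-9093, -2073, 1648],
    ![922, -5176, -8752]], ![![1316, -6666, -3918], ![-18836, 1446, 1507], ![-10938, -28663,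
    16867]], ![![-1065, -5798, -3167], ![18895, -8081, -2388], ![10489, -36522, 14105]],
    ![![504, 14035, -1137], ![-261, 6964, -450], ![637, 6297, 17]], ![![-1981, 10140, 1349],
    ![-155, 1500, 169], ![-1940, 8552, 1505]]]]

/-- Approximate zeros of `largeForm`, scaled by `1000`. -/
def largeCenter : Fin 32 → Fin 5 → ℤ :=
  ![![-69305, -5520, -193720, 35096, 2795],
    ![-36548, -3098, -139433, 45000, 3815],
    ![-21757, -3945, -18379, 4659, 845],
    ![-10472, -8697, -58947, 6778, 5629],
    ![-9000, -3797, -4301, 1133, 478],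
    ![-6342, -3276, -59918, 18289, 9448],
    ![-1200, 11543, -85399, -7398, 71172],
    ![-1195, -504, 111, -220, -93],
    ![-1189, 12988, -66709, -5136, 56106],
    ![-1112, -195, 40, -204, -36],
    ![-1106, 2671, -12110, -4534, 10948],
    ![-1104, -393, 30, -76, -27],
    ![-1044, -207, 20, -96, -19],
    ![-1033, 2748, -24807, -9026, 24010],
    ![-956, 2019, -7829, -3878, 8188],
    ![-870, 2004, -15418, -7692, 17717],
    ![-842, -277, 12, -43, -14],
    ![-834, 4049, -21531, -5317, 25828],
    ![-820, 4432, -14877, -3357, 18141],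
    ![-820, -133, 19, -143, -23],
    ![-814, -157, 9, -58, -11],
    ![-812, -326, 48, -148, -59],
    ![-91, 54, 16, 292, -172],
    ![6, -36, -3, 97, -551],
    ![24, -132, -15, 111, -611],
    ![99, -53, -24, 462, -245],
    ![228, -538, -872, 1622, -3830],
    ![301, -754, -907, 1202, -3017],
    ![747, -670, -6707, 10005, -8979],
    ![1673, -958, -6597, 6887, -3942],
    ![5131, 3111, 2596, 834, 506],
    ![111936, 15855, 94326, 5949, 843]]

/-- Approximate inverses of the Jacobians of `largeForm` at `largeCenter`. -/
def largeInverse : Fin 32 → Fin 5 → Fin 5 → ℤ :=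
  ![![![354, 452, 1, 882104, 3730927], ![-3, 35, -5, 31470, 271472], ![787, 841, 230, 2318102,
    10275258], ![-161, 68, -71, -219873, -1947135], ![3, 6, -3, -142160, 2212]],
    ![![714, -305, 71, 616508, 3122804], ![4, -21, 0, -3549, 213993], ![1832, -390, 579,
    2827583, 11177386], ![-532, -175, -190, -964120, -3726872], ![24, -21, -8, -286623, 20142]],
    ![![1889, -4234, 138, -1066012, 12489040], ![18, -616, 52, -253561, 1914330], ![2313,
    -3626, -419, -584742, 11236159], ![-565, 192, 168, -151206, -3122386], ![-33, 2, 25,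
    -474137, -31546]],
    ![![-157, 402, -77, 777196, 886302], ![69, 402, -49, 602399, 1257973], ![-305, 1232, 256,
    4525154, 6794800], ![89, 172, -68, -50853, -950731], ![-55, 98, -66, -969287, -172442]],
    ![![-1955, -8172, 838, -1978364, 11683004], ![-20, -4253, 352, -1303202, 6276074], ![-1804,
    -3210, -349, 210911, 3832979], ![469, -423, 197, -444278, -1770798], ![97, -77, 83,
    -1239572, 194465]],
    ![![-363, 11, 1, 454693, -44544], ![45, -76, 4, 66928, 500181], ![-693, 892, 995, 5469153,
    6713044], ![461, -699, -283, -1295762, -2309181], ![-432, -125, -155, -1761856, -1124926]],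
    ![![0, 0, 10, 154850, 30444], ![136, -520, -386, -899529, -2503560], ![1746, 3155, 3456,
    8275394, 23882296], ![239, -60, 52, 140392, 1330694], ![-1446, -2640, -2282, -6045882,
    -18097803]],
    ![![706, 6595, 23575, -52917913, 74241889], ![7082, 16805, 10503, -17761807, 49054448],
    ![-1579, -19146, -4299, -518000, -31188483], ![42, 30656, 3947, 8779632, 20633863], ![1267,
    15513, 1768, -3826953, 20339412]],
    ![![-2, -2, 15, 195335, 40419], ![-134, -760, -629, -1439137, -4371930], ![-1859, 3923,
    4239, 8165128, 21492285], ![-196, 1, 78, 59542, 695798], ![1461, -3384, -2881, -6060394,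
    -16169132]],
    ![![-3964, 29087, 33729, -59958549, 113597571], ![-8131, -5210, 7365, -22535561, 12316602],
    ![1847, -9868, -2827, 779254, -19699458], ![-945, 55975, 6766, 19599707, 36766474],
    ![-1533, 7935, 1453, -7757418, 14047073]],
    ![![43, -220, 665, 1798658, 2152962], ![45, 2068, -3389, -3488445, -12550588], ![-4103,
    -12105, 23323, 25513117, 75416519], ![-1461, -1021, 2978, 3630212, 10674061], ![4135, 8771,
    -14500, -14303621, -46871613]],
    ![![3379, -43226, 40990, -121463221, 124279571], ![12096, -39048, 18378, -62920604,
    65773296], ![-463, 17055, -3651, 14793653, -15895384], ![-1160, -35805, 5729, -25447754,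
    2281451], ![336, -14388, 2301, -19479261, 11349827]],
    ![![-4794, -45187, 43444, -128974048, 128389352], ![-12621, 8192, 9490, -23426925,
    19331757], ![894, 11374, -2501, 10929115, -13071759], ![1531, -58664, 7674, -41878103,
    5868625], ![-769, -10071, 1603, -17694192, 10178090]],
    ![![-12, -90, 194, 638630, 629898], ![-17, 758, -1037, -967214, -4505983], ![3855, -7408,
    13477, 17447180, 59214328], ![1348, -205, 1498, 3171712, 10385595], ![-4007, 5081, -8540,
    -11724557, -42673412]],
    ![![79, 410, -1088, 15752, -3851965], ![7, -479, 4041, 5599017, 12485214], ![-4110, 5338,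
    -25094, -32949422, -89714162], ![-2022, 1723, -4668, -5565400, -15501349], ![4973, -2076,
    16929, 24135083, 60838563]],
    ![![-25, 100, -326, 169208, -1348229], ![7, -84, 1271, 1784852, 3937604], ![3861, 3780,
    -15402, -16250651, -47701143], ![1954, 1564, -2807, -1258245, -3698868], ![-4948, -2305,
    11061, 10627634, 27365787]],
    ![![5655, 18836, -42095, 134640281, -163397084], ![18502, -16620, -18556, 50446843,
    -57116201], ![-341, 9367, 2111, -4509416, 3700945], ![-1649, -31227, -4733, 8428402,
    -40570387], ![310, -11443, -1798, -8789342, -1643202]],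
    ![![6, 14, -71, 333134, -291406], ![130, -761, 761, 192404, 1242113], ![3606, 3457, -5782,
    -1173365, -8308955], ![1061, -146, -429, -37116, 2048778], ![-4140, -3728, 4746, -266711,
    938604]],
    ![![-7, 15, -120, 466572, -530535], ![-276, -1325, 1452, 132950, 2283739], ![-2933, 4816,
    -7224, -2524923, -24324234], ![-871, 83, -530, -469019, -1502357], ![3418, -5542, 6164,
    1205771, 17925071]],
    ![![1538, 16561, -34845, 109239751, -143853338], ![-9736, -9527, -7287, 12693422,
    -48373516], ![1425, -6542, 2066, -9188612, -1442063], ![-261, 59468, -7711, 55501996,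
    -12405868], ![-1782, 7511, -1535, -4074320, 5820962]],
    ![![-2316, 13784, -43725, 137215890, -190700540], ![-17529, 25929, -9635, 34213345,
    -55067694], ![545, 6937, 1615, -2811283, 1526855], ![3004, -53820, -6733, 5278139,
    -53145810], ![-638, -8711, -1383, -10714778, 741113]],
    ![![490, -2869, -25259, 75351609, -112566930], ![10425, 14955, -12205, 41717276,
    -28827221], ![-1633, -12950, 3520, -17304859, -2257677], ![285, 32917, -5262, 34146736,
    -10676043], ![1975, 16152, -2488, 3487890, 11003095]],
    ![![14300, 5403, 544, -25652793, 56964885], ![-8982, 438, 82, -17666374, 1856459], ![-1960,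
    -220, 220, -6152825, -6976885], ![12402, -6492, 3650, -18508513, 46325905], ![-5398, -7751,
    -3430, 6059511, -30625385]],
    ![![4130, -355, 238, -18076760, 26100075], ![-23170, 4451, -1005, -1032025, -39562200],
    ![-2364, 275, -174, 150936, -14784964], ![2946, 4441, 2115, -7036596, 25949995], ![-14259,
    12616, -6692, 31326724, -65539261]],
    ![![-4355, 1026, 605, -17732230, 13443705], ![23305, 1948, -2128, 5281886, 31657083],
    ![3024, -407, -553, 1668112, -8771947], ![-3374, 4704, 2398, -8192189, 17180414], ![15082,
    9209, -7623, 34487794, -23044744]],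
    ![![-16705, -1494, 1220, -42763638, 15329432], ![8546, -962, -877, 156258, 12106228],
    ![4762, -61, -625, 1977435, -5260888], ![-15494, -7296, 4192, -36287475, 16267664], ![6704,
    -4330, -3297, 15012188, -15166779]],
    ![![857, 591, -365, -1458123, 1650752], ![-2268, -307, 654, -1836369, 1757270], ![-1325,
    -3434, 2365, -5798736, 3883320], ![-4377, 5461, -2427, 5246091, -20521054], ![8607, -5135,
    4252, -6078843, 44834196]],
    ![![-630, 1088, -640, -1393367, -1943804], ![2260, -638, 1113, -2786591, 13464579], ![-708,
    -4052, 3273, -8456280, 11653945], ![4541, 4355, -2565, 6770709, -7250572], ![-8679, -2565,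
    4462, -8851690, 19265809]],
    ![![462, -122, -121, -838257, 544547], ![-254, 15, 84, -222911, 733219], ![-1740, 2231,
    1833, -95915, 6291513], ![-1200, -3109, -1479, -3183785, -13359720], ![3225, 1516, 997,
    3182689, 14969359]],
    ![![-709, -613, -397, -2043699, -2682343], ![45, 8, 148, -412146, 2148045], ![-3135, 2557,
    2693, -3255378, 12811796], ![3600, -2609, -1745, 435300, -8371046], ![-3543, 84, 674,
    -784151, 1337032]],
    ![![2319, 9847, 2092, 10499123, 21564359], ![511, 4810, 1337, 5591502, 10793163], ![1417,
    3941, 1889, 4091822, 10860428], ![318, -24, 249, -184567, 3809941], ![48, -203, 162,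
    1710985, -9869]],
    ![![-929, 2667, 758, 2867680, 10338776], ![-92, 394, 101, 445400, 1504054], ![-859, 2251,
    761, 2432359, 8634149], ![-20, -6, 10, -13719, 610917], ![-1, 0, 1, 89478, -698]]]

/-- The quadratic form `y 0 * y 5 - y 2 * y 3` or `y 1 * y 4 - y 2 * y 3`. -/
def toric (i : Fin 2) (k l : Fin 6) : ℤ :=
  if k = ![0, 1] i ∧ l = ![5, 4] i then 1 else if k = 2 ∧ l = 3 then -1 else 0

/-- The conditions cutting out the large stratum. -/
def largeCondition : Fin 5 → Fin 6 → Fin 6 → ℤ :=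
  Fin.append (fun j : Fin 3 => tangency (weight 0) (lineStart j) (lineEnd j)) toric

lemma smallForm_eq : ∀ s j k l, smallForm s j k l =
    tangency (weight s.succ) (lineStart j) (lineEnd j) (chart s k) (chart s l) := by
  decide +kernel

lemma largeForm_eq : ∀ m k l, largeForm m k l =
    largeCondition m (largeChart k) (largeChart l) := by
  decide +kernel

lemma newtonBound_small_lt : ∀ s i r,
    newtonBound (smallForm s) 1000 10000000000 (smallCenter s i) (smallInverse s i) r <
      10000000000 := by
  decide +kernel

lemma newtonBound_large_lt : ∀ i r,
    newtonBound largeForm 1000 10000000000 (largeCenter i) (largeInverse i) r < 10000000000 := by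
  decide +kernel

lemma one_lt_abs_smallCenter : ∀ s i k, 1 < |smallCenter s i k| := by decide +kernel

lemma one_lt_abs_largeCenter : ∀ i k, 1 < |largeCenter i k| := by decide +kernel

lemma smallCenter_separated :
    ∀ s i i', i ≠ i' → ∃ k, 2 < |smallCenter s i k - smallCenter s i' k| := by decide +kernel

lemma largeCenter_separated :
    ∀ i i', i ≠ i' → ∃ k, 2 < |largeCenter i k - largeCenter i' k| := by decide +kernel

lemma smallCenter_minor : ∀ s i,
    (s = 3 ∨ s = 5 → |smallCenter s i 0| + |smallCenter s i 2| + 1001 <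
      |smallCenter s i 0 * smallCenter s i 2 - 1000 * smallCenter s i 1|) ∧
    (s = 4 → |smallCenter s i 1| + |smallCenter s i 2| + 1001 <
      |smallCenter s i 1 * smallCenter s i 2 - 1000 * smallCenter s i 0|) := by
  decide +kernel

lemma exists_real_zero {n : ℕ} (c : Fin (n + 1) → Fin 6) (hc : Function.Injective c)
    (F : Fin n → Fin 6 → Fin 6 → ℤ) (X : Fin n → ℤ) (A : Fin n → Fin n → ℤ)
    (h : ∀ r, newtonBound (fun m k l => F m (c k) (c l)) 1000 10000000000 X A r < 10000000000) :
    ∃ α : Fin 6 → ℝ, (∀ e, e ∉ Set.range c → α e = 0) ∧ α (c 0) = 1 ∧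
      (∀ k : Fin n, |1000 * α (c k.succ) - X k| ≤ 1) ∧ ∀ m, quadEval (F m) α = 0 := by
  obtain ⟨x, hx, hz⟩ := exists_zero_of_newtonBound _ _ _ _ _ (by norm_num) (by norm_num) h
  set y : Fin (n + 1) → ℝ := Fin.cons 1 x with hy
  have hα : ∀ k, Function.extend c y 0 (c k) = y k := fun k => hc.extend_apply _ _ _
  have h0 : ∀ e, e ∉ Set.range c → Function.extend c y 0 e = 0 := fun e he =>
    Function.extend_apply' _ _ _ he
  refine ⟨Function.extend c y 0, h0, by rw [hα]; rfl, fun k => ?_, fun m => ?_⟩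
  · rw [hα]
    simpa [hy] using hx k
  · rw [← hz m, quadEval, quadEval]
    refine (Fintype.sum_of_injective c hc _ _ (fun e he => ?_) fun k => ?_).symm
    · simp [h0 e he]
    · refine Fintype.sum_of_injective c hc _ _ (fun e he => ?_) fun l => ?_
      · simp [h0 e he]
      · rw [hα, hα]

lemma mul_ne_of_lt_abs {x y z : ℝ} {X Y Z : ℤ} (hx : |1000 * x - X| ≤ 1)
    (hy : |1000 * y - Y| ≤ 1) (hz : |1000 * z - Z| ≤ 1)
    (h : |X| + |Z| + 1001 < |X * Z - 1000 * Y|) : x * z ≠ y := by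
  rintro rfl
  have h' : |(X : ℝ)| + |(Z : ℝ)| + 1001 < |(X : ℝ) * Z - 1000 * Y| := by exact_mod_cast h
  have e : (X : ℝ) * Z - 1000 * Y = -((1000 * x - X) * (1000 * z - Z)) + -((1000 * x - X) * Z) +
      -(X * (1000 * z - Z)) + 1000 * (1000 * (x * z) - Y) := by ring
  have h1 : |(1000 * x - X) * (1000 * z - Z)| ≤ 1 := by
    rw [abs_mul]
    exact mul_le_one₀ hx (abs_nonneg _) hz
  have h2 : |(1000 * x - X) * Z| ≤ |(Z : ℝ)| := by
    rw [abs_mul]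
    exact mul_le_of_le_one_left (abs_nonneg _) hx
  have h3 : |X * (1000 * z - Z)| ≤ |(X : ℝ)| := by
    rw [abs_mul]
    exact mul_le_of_le_one_right (abs_nonneg _) hz
  have h4 : |1000 * (1000 * (x * z) - Y)| ≤ 1000 := by
    rw [abs_mul, abs_of_pos (by norm_num : (0 : ℝ) < 1000)]
    linarith
  rw [e] at h'
  have := abs_add_le (-((1000 * x - X) * (1000 * z - Z)) + -((1000 * x - X) * Z) +
      -(X * (1000 * z - Z))) (1000 * (1000 * (x * z) - Y))
  have := abs_add_three (-((1000 * x - X) * (1000 * z - Z))) (-((1000 * x - X) * Z))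
    (-(X * (1000 * z - Z)))
  rw [abs_neg, abs_neg, abs_neg] at this
  linarith

/-- The off-diagonal entries of the solutions in the stratum `σ`, normalised at `base σ`. -/
def IsPoint {R : Type*} [CommRing R] (σ : Fin 10) (α : Fin 6 → R) : Prop :=
  α (base σ) = 1 ∧ (∀ e ∉ support σ, α e = 0) ∧
    (∀ j, quadEval (tangency (weight σ) (lineStart j) (lineEnd j)) α = 0) ∧
    (σ = 0 → α 0 * α 5 = α 2 * α 3 ∧ α 1 * α 4 = α 2 * α 3)

/-- The conditions on a point of the stratum `σ` ensuring that its quadric is smooth. -/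
def IsNondegenerate {R : Type*} [CommRing R] (σ : Fin 10) (α : Fin 6 → R) : Prop :=
  (∀ e ∈ support σ, α e ≠ 0) ∧ (σ = 4 → α 1 * α 4 ≠ α 2 * α 3) ∧
    (σ = 5 → α 0 * α 5 ≠ α 2 * α 3) ∧ (σ = 6 → α 0 * α 5 ≠ α 1 * α 4)

/-- The number of points of each stratum. -/
def size : Fin 10 → ℕ := Fin.cons 32 fun _ => 8

lemma ne_zero_of_one_lt_abs {x : ℝ} {X : ℤ} (hx : |1000 * x - X| ≤ 1) (hX : 1 < |X|) : x ≠ 0 := by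
  rintro rfl
  have h : (1 : ℝ) < |(X : ℝ)| := by exact_mod_cast hX
  rw [mul_zero, zero_sub, abs_neg] at hx
  linarith

lemma injective_of_separated {ι κ : Type*} {n : ℕ} (P : ι → κ → ℝ) (c : Fin n → κ)
    (X : ι → Fin n → ℤ) (hP : ∀ i k, |1000 * P i (c k) - X i k| ≤ 1)
    (hX : ∀ i i', i ≠ i' → ∃ k, 2 < |X i k - X i' k|) : Function.Injective P := by
  intro i i' h
  by_contra hne
  obtain ⟨k, hk⟩ := hX i i' hne
  have h' : (2 : ℝ) < |(X i k : ℝ) - X i' k| := by exact_mod_cast hk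
  have h1 := hP i k
  have h2 := hP i' k
  rw [h] at h1
  rw [abs_le] at h1 h2
  rw [lt_abs] at h'
  rcases h' with h' | h' <;> linarith

lemma chart_zero (s : Fin 9) : chart s 0 = base s.succ := by
  revert s
  decide

lemma mem_support_iff (s : Fin 9) (e : Fin 6) : e ∈ support s.succ ↔ e ∈ Set.range (chart s) := by
  simp only [Set.mem_range]
  revert s e
  decide

lemma exists_small_points (s : Fin 9) : ∃ P : Fin 8 → Fin 6 → ℝ, Function.Injective P ∧
    ∀ i, IsPoint s.succ (P i) ∧ IsNondegenerate s.succ (P i) := by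
  have hc : Function.Injective (chart s) := by
    revert s
    unfold Function.Injective
    decide
  choose P h0 h1 hP hz using fun i => exists_real_zero (chart s) hc
    (fun j => tangency (weight s.succ) (lineStart j) (lineEnd j)) (smallCenter s i)
    (smallInverse s i) (by
      have e : (fun m k l => tangency (weight s.succ) (lineStart m) (lineEnd m) (chart s k)
          (chart s l)) = smallForm s := by
        ext m k l
        exact (smallForm_eq s m k l).symm
      simp only [e]
      exact newtonBound_small_lt s i)
  refine ⟨P, injective_of_separated P (fun k => chart s (Fin.succ k)) (smallCenter s) hP
    (smallCenter_separated s), fun i => ⟨⟨?_, fun e he => ?_, hz i, fun h => ?_⟩, fun e he => ?_,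
      fun h => ?_, fun h => ?_, fun h => ?_⟩⟩
  · rw [← chart_zero, h1]
  · exact h0 i e (by rwa [mem_support_iff] at he)
  · exact absurd h (Fin.succ_ne_zero s)
  · rw [mem_support_iff] at he
    obtain ⟨k, rfl⟩ := he
    refine Fin.cases ?_ (fun k => ?_) k
    · rw [h1]
      exact one_ne_zero
    · exact ne_zero_of_one_lt_abs (hP i k) (one_lt_abs_smallCenter s i k)
  · obtain rfl : s = 3 := Fin.succ_injective _ h
    have e : P i 2 = 1 := h1 i
    have := mul_ne_of_lt_abs (hP i 0) (hP i 1) (hP i 2)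
      ((smallCenter_minor 3 i).1 (Or.inl rfl))
    rw [e, one_mul]
    exact this
  · obtain rfl : s = 4 := Fin.succ_injective _ h
    have e : P i 5 = 1 := h1 i
    have := mul_ne_of_lt_abs (hP i 1) (hP i 0) (hP i 2) ((smallCenter_minor 4 i).2 rfl)
    rw [e, mul_one]
    exact this.symm
  · obtain rfl : s = 5 := Fin.succ_injective _ h
    have e : P i 4 = 1 := h1 i
    have := mul_ne_of_lt_abs (hP i 0) (hP i 1) (hP i 2)
      ((smallCenter_minor 5 i).1 (Or.inr rfl))
    rw [e, mul_one]
    exact this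

lemma quadEval_toric {R : Type*} [CommRing R] (y : Fin 6 → R) :
    quadEval (toric 0) y = y 0 * y 5 - y 2 * y 3 ∧
      quadEval (toric 1) y = y 1 * y 4 - y 2 * y 3 := by
  constructor <;> simp [quadEval, toric, Fin.sum_univ_six] <;> ring

lemma exists_large_points : ∃ P : Fin 32 → Fin 6 → ℝ, Function.Injective P ∧
    ∀ i, IsPoint 0 (P i) ∧ IsNondegenerate 0 (P i) := by
  have hc : Function.Bijective largeChart := by decide
  choose P h0 h1 hP hz using fun i => exists_real_zero largeChart hc.1 largeCondition
    (largeCenter i) (largeInverse i) (by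
      have e : (fun m k l => largeCondition m (largeChart k) (largeChart l)) = largeForm := by
        ext m k l
        exact (largeForm_eq m k l).symm
      rw [e]
      exact newtonBound_large_lt i)
  refine ⟨P, injective_of_separated P (fun k => largeChart (Fin.succ k)) largeCenter hP
    largeCenter_separated, fun i => ⟨⟨h1 i, fun e he => ?_, fun j => ?_, fun _ => ⟨?_, ?_⟩⟩,
      fun e _ => ?_, fun h => ?_, fun h => ?_, fun h => ?_⟩⟩
  · exact absurd (Finset.mem_univ e) he
  · have := hz i (Fin.castAdd 2 j)
    rwa [largeCondition, Fin.append_left] at this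
  · have := hz i (Fin.natAdd 3 (0 : Fin 2))
    rwa [largeCondition, Fin.append_right, (quadEval_toric _).1, sub_eq_zero] at this
  · have := hz i (Fin.natAdd 3 (1 : Fin 2))
    rwa [largeCondition, Fin.append_right, (quadEval_toric _).2, sub_eq_zero] at this
  · obtain ⟨k, rfl⟩ := hc.2 e
    refine Fin.cases ?_ (fun k => ?_) k
    · rw [h1]
      exact one_ne_zero
    · exact ne_zero_of_one_lt_abs (hP i k) (one_lt_abs_largeCenter i k)
  all_goals exact absurd h (by decide)

lemma exists_points (σ : Fin 10) : ∃ P : Finset (Fin 6 → ℝ), P.card = size σ ∧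
    ∀ α ∈ P, IsPoint σ α ∧ IsNondegenerate σ α := by
  have key : ∀ n (P : Fin n → Fin 6 → ℝ), Function.Injective P →
      (∀ i, IsPoint σ (P i) ∧ IsNondegenerate σ (P i)) → ∃ Q : Finset (Fin 6 → ℝ), Q.card = n ∧
        ∀ α ∈ Q, IsPoint σ α ∧ IsNondegenerate σ α := by
    intro n P hP h
    refine ⟨Finset.univ.map ⟨P, hP⟩, by simp, fun α hα => ?_⟩
    obtain ⟨i, -, rfl⟩ := Finset.mem_map.1 hα
    exact h i
  revert key
  refine Fin.cases (fun key => ?_) (fun s key => ?_) σ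
  · obtain ⟨P, hP, h⟩ := exists_large_points
    exact key _ P hP h
  · obtain ⟨P, hP, h⟩ := exists_small_points s
    exact key _ P hP h

lemma entryCoeff_spec : ∀ s, ∀ e, ∀ f ∈ support s.succ, (if e = f then 1 else 0) =
    (if f = base s.succ then entryCoeff s e 0 else 0) +
      ∑ j : Fin 3, entryCoeff s e j.succ * parity j f := by
  decide +kernel

lemma eq_of_isPoint (s : Fin 9) (α : Fin 6 → ℂ) (h : IsPoint s.succ α) (e : Fin 6) :
    α e = entryCoeff s e 0 +
      ∑ j : Fin 3, entryCoeff s e j.succ * ∑ f, (parity j f : ℂ) * α f := by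
  have h1 : ∀ f, (if e = f then 1 else 0) * α f =
      (if f = base s.succ then (entryCoeff s e 0 : ℂ) else 0) * α f +
        ∑ j : Fin 3, (entryCoeff s e j.succ : ℂ) * (parity j f * α f) := by
    intro f
    by_cases hf : f ∈ support s.succ
    · have := congrArg (Int.cast : ℤ → ℂ) (entryCoeff_spec s e f hf)
      push_cast at this
      rw [this, add_mul, Finset.sum_mul]
      simp only [mul_assoc]
    · simp [h.2.1 f hf]
  have h2 := Finset.sum_congr (rfl : (Finset.univ : Finset (Fin 6)) = Finset.univ)
    fun f _ => h1 f
  rw [Finset.sum_add_distrib, Finset.sum_comm] at h2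
  simpa [Finset.mul_sum, h.1] using h2

lemma card_le_size (σ : Fin 10) (S : Finset (Fin 6 → ℂ)) (hS : ∀ α ∈ S, IsPoint σ α) :
    S.card ≤ size σ := by
  revert hS
  refine Fin.cases (fun hS => ?_) (fun s hS => ?_) σ
  · exact card_le_thirty_two _ _ _ two_dvd_polar_sub_parity S (fun α h => (hS α h).2.2.1)
      (fun α h => (hS α h).1)
      (fun α h => by
        have h2 : α 2 = 1 := (hS α h).1
        simpa [h2] using ((hS α h).2.2.2 rfl).1)
      (fun α h => by
        have h2 : α 2 = 1 := (hS α h).1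
        simpa [h2] using ((hS α h).2.2.2 rfl).2)
  · exact card_le_eight _ _ _ two_dvd_polar_sub_parity S (fun α h => (hS α h).2.2.1)
      (entryCoeff s) (fun α h => eq_of_isPoint s α (hS α h))

lemma quadEval_map {ι R R' : Type*} [Fintype ι] [CommRing R] [CommRing R'] (f : R →+* R')
    (G : ι → ι → ℤ) (y : ι → R) : quadEval G (fun k => f (y k)) = f (quadEval G y) := by
  simp [quadEval, map_sum]

lemma IsPoint.ofReal {σ : Fin 10} {α : Fin 6 → ℝ} (h : IsPoint σ α) :
    IsPoint σ fun e => (α e : ℂ) := by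
  refine ⟨by simp [h.1], fun e he => by simp [h.2.1 e he], fun j => ?_, fun hσ => ?_⟩
  · have := quadEval_map Complex.ofRealHom (tangency (weight σ) (lineStart j) (lineEnd j)) α
    rw [h.2.2.1 j, map_zero] at this
    exact this
  · beta_reduce
    exact_mod_cast h.2.2.2 hσ

lemma IsNondegenerate.ofReal {σ : Fin 10} {α : Fin 6 → ℝ} (h : IsNondegenerate σ α) :
    IsNondegenerate σ fun e => (α e : ℂ) := by
  refine ⟨fun e he => ?_, fun hσ => ?_, fun hσ => ?_, fun hσ => ?_⟩ <;> beta_reduce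
  · exact_mod_cast h.1 e he
  · exact_mod_cast h.2.1 hσ
  · exact_mod_cast h.2.2.1 hσ
  · exact_mod_cast h.2.2.2 hσ

lemma exists_complete_points (σ : Fin 10) : ∃ P : Finset (Fin 6 → ℂ), P.card = size σ ∧
    (∀ α, IsPoint σ α → α ∈ P) ∧ ∀ α ∈ P, IsPoint σ α ∧ IsNondegenerate σ α ∧
      ∃ β : Fin 6 → ℝ, α = fun e => (β e : ℂ) := by
  classical
  obtain ⟨Q, hQ, h⟩ := exists_points σ
  have hinj : Function.Injective fun (β : Fin 6 → ℝ) (e : Fin 6) => (β e : ℂ) := fun β γ hβ =>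
    funext fun e => Complex.ofReal_injective (congrFun hβ e)
  set P := Q.map ⟨_, hinj⟩ with hP
  have hmem : ∀ α ∈ P, IsPoint σ α ∧ IsNondegenerate σ α ∧
      ∃ β : Fin 6 → ℝ, α = fun e => (β e : ℂ) := by
    intro α hα
    obtain ⟨β, hβ, rfl⟩ := Finset.mem_map.1 hα
    exact ⟨(h β hβ).1.ofReal, (h β hβ).2.ofReal, β, rfl⟩
  have hcard : P.card = size σ := by rw [hP, Finset.card_map, hQ]
  refine ⟨P, hcard, fun α hα => ?_, hmem⟩
  by_contra hn
  have := card_le_size σ (insert α P) fun γ hγ => by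
    rcases Finset.mem_insert.1 hγ with rfl | hγ
    · exact hα
    · exact (hmem γ hγ).1
  rw [Finset.card_insert_of_notMem hn, hcard] at this
  omega

/-- The symmetric matrix with diagonal `0, 0, 0, c` and off-diagonal entries `α`. -/
def quadric (α : Fin 6 → ℂ) (c : ℂ) : Matrix (Fin 4) (Fin 4) ℂ :=
  !![0, α 0, α 1, α 2; α 0, 0, α 3, α 4; α 1, α 3, 0, α 5; α 2, α 4, α 5, c]

/-- The last diagonal entry on the stratum `σ`. -/
noncomputable def lastEntry (σ : Fin 10) (α : Fin 6 → ℂ) : ℂ :=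
  ![2 * α 2 * α 4 / α 0, 2 * α 2 * α 4 / α 0, 2 * α 2 * α 5 / α 1, 2 * α 4 * α 5 / α 3,
    0, 0, 0, 0, 0, 0] σ

/-- The determinant of `quadric α c`. -/
def discriminant (α : Fin 6 → ℂ) (c : ℂ) : ℂ :=
  2 * α 0 * α 1 * α 3 * c + (α 0 * α 5) ^ 2 + (α 1 * α 4) ^ 2 + (α 2 * α 3) ^ 2 -
    2 * (α 0 * α 5) * (α 1 * α 4) - 2 * (α 0 * α 5) * (α 2 * α 3) - 2 * (α 1 * α 4) * (α 2 * α 3)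

/-- The tangency condition of `quadric α c` to the line through `a` and `b`. -/
def lineForm (a b : Fin 4 → ℤ) (α : Fin 6 → ℂ) (c : ℂ) : ℂ :=
  quadEval (tangency 0 a b) α + 2 * c *
    (α 0 * ((a 0 * b 3 - a 3 * b 0) * (a 1 * b 3 - a 3 * b 1)) +
      α 1 * ((a 0 * b 3 - a 3 * b 0) * (a 2 * b 3 - a 3 * b 2)) +
      α 3 * ((a 1 * b 3 - a 3 * b 1) * (a 2 * b 3 - a 3 * b 2)))

/-- The conditions on `α` and `c` for `quadric α c` to be a solution of the tangency problem. -/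
def Solves (α : Fin 6 → ℂ) (c : ℂ) : Prop :=
  discriminant α c ≠ 0 ∧ (∀ j, lineForm (lineStart j) (lineEnd j) α c = 0) ∧
    α 0 * (2 * α 2 * α 4 - c * α 0) = 0 ∧ α 1 * (2 * α 2 * α 5 - c * α 1) = 0 ∧
    α 3 * (2 * α 4 * α 5 - c * α 3) = 0

lemma lineForm_eq (ε : Fin 3 → ℤ) (a b : Fin 4 → ℤ) (α : Fin 6 → ℂ) (c : ℂ)
    (h0 : c * α 0 = ε 0 * (2 * α 2 * α 4)) (h1 : c * α 1 = ε 1 * (2 * α 2 * α 5))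
    (h3 : c * α 3 = ε 2 * (2 * α 4 * α 5)) :
    lineForm a b α c = quadEval (tangency ε a b) α := by
  rw [lineForm, quadEval_tangency, quadEval_tangency, quadEval_correction, quadEval_correction]
  simp only [Pi.zero_apply, Int.cast_zero]
  linear_combination 2 * ((a 0 * b 3 - a 3 * b 0) * (a 1 * b 3 - a 3 * b 1)) * h0 +
    2 * ((a 0 * b 3 - a 3 * b 0) * (a 2 * b 3 - a 3 * b 2)) * h1 +
    2 * ((a 1 * b 3 - a 3 * b 1) * (a 2 * b 3 - a 3 * b 2)) * h3

lemma lastEntry_mul {σ : Fin 10} {α : Fin 6 → ℂ} (h : IsPoint σ α) (hn : IsNondegenerate σ α) :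
    lastEntry σ α * α 0 = weight σ 0 * (2 * α 2 * α 4) ∧
      lastEntry σ α * α 1 = weight σ 1 * (2 * α 2 * α 5) ∧
      lastEntry σ α * α 3 = weight σ 2 * (2 * α 4 * α 5) := by
  obtain ⟨-, h0, -, ht⟩ := h
  obtain ⟨hn, -⟩ := hn
  fin_cases σ
  · obtain ⟨h05, h14⟩ := ht rfl
    have := hn 0 (by decide)
    simp only [lastEntry, weight]
    simp
    field_simp
    refine ⟨trivial, ?_, ?_⟩
    · linear_combination α 2 * h14 - α 2 * h05
    · linear_combination -α 4 * h05
  all_goals simp_all [lastEntry, weight, support]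

lemma discriminant_ne_zero {σ : Fin 10} {α : Fin 6 → ℂ} (h : IsPoint σ α)
    (hn : IsNondegenerate σ α) : discriminant α (lastEntry σ α) ≠ 0 := by
  obtain ⟨hb, h0, -, ht⟩ := h
  obtain ⟨hn, h4, h5, h6⟩ := hn
  fin_cases σ
  · obtain ⟨h05, h14⟩ := ht rfl
    have := hn 0 (by decide)
    have h2 := hn 2 (by decide)
    have h3 := hn 3 (by decide)
    have e : lastEntry 0 α * α 0 = 2 * α 2 * α 4 := div_mul_cancel₀ _ this
    intro (h : discriminant α (lastEntry 0 α) = 0)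
    refine mul_ne_zero h2 h3 (pow_eq_zero_iff two_ne_zero |>.1 ?_)
    rw [discriminant, h05, h14] at h
    linear_combination h - 2 * α 1 * α 3 * e - 4 * α 2 * α 3 * h14
  all_goals simp_all [discriminant, lastEntry, support]
  · intro h
    exact h4 (sub_eq_zero.1 (pow_eq_zero_iff two_ne_zero |>.1 (by linear_combination h)))
  · intro h
    exact h5 (sub_eq_zero.1 (pow_eq_zero_iff two_ne_zero |>.1 (by linear_combination h)))
  · intro h
    exact h6 (sub_eq_zero.1 (pow_eq_zero_iff two_ne_zero |>.1 (by linear_combination h)))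

lemma solves_of_isPoint {σ : Fin 10} {α : Fin 6 → ℂ} (h : IsPoint σ α)
    (hn : IsNondegenerate σ α) : Solves α (lastEntry σ α) := by
  obtain ⟨e0, e1, e3⟩ := lastEntry_mul h hn
  have key : ∀ (i : Fin 3) (e f g : Fin 6),
      weight σ i = 1 ∨ e ∉ support σ ∨ f ∉ support σ ∨ g ∉ support σ →
      lastEntry σ α * α e = weight σ i * (2 * α f * α g) →
      α e * (2 * α f * α g - lastEntry σ α * α e) = 0 := by
    rintro i e f g hw hx
    rcases hw with hw | he | hf | hg
    · rw [hx, hw, Int.cast_one, one_mul, sub_self, mul_zero]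
    · rw [h.2.1 e he, zero_mul]
    · rw [hx, h.2.1 f hf]
      ring
    · rw [hx, h.2.1 g hg]
      ring
  have hw : ∀ σ,
      (weight σ 0 = 1 ∨ 0 ∉ support σ ∨ 2 ∉ support σ ∨ 4 ∉ support σ) ∧
      (weight σ 1 = 1 ∨ 1 ∉ support σ ∨ 2 ∉ support σ ∨ 5 ∉ support σ) ∧
      (weight σ 2 = 1 ∨ 3 ∉ support σ ∨ 4 ∉ support σ ∨ 5 ∉ support σ) := by
    decide
  refine ⟨discriminant_ne_zero h hn, fun j => ?_, key 0 0 2 4 (hw σ).1 e0,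
    key 1 1 2 5 (hw σ).2.1 e1, key 2 3 4 5 (hw σ).2.2 e3⟩
  rw [lineForm_eq _ _ _ _ _ e0 e1 e3, h.2.2.1 j]

lemma exists_isPoint {σ : Fin 10} {α : Fin 6 → ℂ} {c : ℂ} (hs : Solves α c)
    (hb : α (base σ) ≠ 0) (h0 : ∀ e ∉ support σ, α e = 0) (hc : c = lastEntry σ α)
    (hw0 : c * α 0 = weight σ 0 * (2 * α 2 * α 4)) (hw1 : c * α 1 = weight σ 1 * (2 * α 2 * α 5))
    (hw2 : c * α 3 = weight σ 2 * (2 * α 4 * α 5))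
    (ht : σ = 0 → α 0 * α 5 = α 2 * α 3 ∧ α 1 * α 4 = α 2 * α 3) :
    ∃ σ β, IsPoint σ β ∧ ∃ r : ℂ, r ≠ 0 ∧ α = r • β ∧ c = r * lastEntry σ β := by
  obtain ⟨r, hr⟩ : ∃ r, r = α (base σ) := ⟨_, rfl⟩
  rw [← hr] at hb
  have hα : α = r • (r⁻¹ • α) := by rw [smul_smul, mul_inv_cancel₀ hb, one_smul]
  refine ⟨σ, r⁻¹ • α, ⟨by simp [← hr, hb], fun e he => by simp [h0 e he], fun j => ?_,
    fun hσ => ?_⟩, r, hb, hα, ?_⟩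
  · have := hs.2.1 j
    rw [lineForm_eq _ _ _ _ _ hw0 hw1 hw2] at this
    have e : quadEval (tangency (weight σ) (lineStart j) (lineEnd j)) (r⁻¹ • α) =
        r⁻¹ ^ 2 * quadEval (tangency (weight σ) (lineStart j) (lineEnd j)) α := by
      simp only [quadEval, Finset.mul_sum, Pi.smul_apply, smul_eq_mul]
      exact Finset.sum_congr rfl fun k _ => Finset.sum_congr rfl fun l _ => by ring
    rw [e, this, mul_zero]
  · obtain ⟨h1, h2⟩ := ht hσ
    simp only [Pi.smul_apply, smul_eq_mul]
    constructor
    · linear_combination r⁻¹ ^ 2 * h1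
    · linear_combination r⁻¹ ^ 2 * h2
  · rw [hc]
    fin_cases σ <;> simp [lastEntry] <;> field_simp

lemma Solves.exists_isPoint_of_eq_zero {α : Fin 6 → ℂ} (hs : Solves α 0) :
    ∃ σ β, IsPoint σ β ∧ ∃ r : ℂ, r ≠ 0 ∧ α = r • β ∧ 0 = r * lastEntry σ β := by
  obtain ⟨hd, -, h0, h1, h3⟩ := id hs
  simp only [zero_mul, sub_zero, mul_eq_zero, OfNat.ofNat_ne_zero, false_or] at h0 h1 h3
  have key : ∀ σ, 4 ≤ σ → α (base σ) ≠ 0 → (∀ e ∉ support σ, α e = 0) →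
      ∃ σ β, IsPoint σ β ∧ ∃ r : ℂ, r ≠ 0 ∧ α = r • β ∧ 0 = r * lastEntry σ β := by
    intro σ hσ hb hz
    have hw : ∀ σ, 4 ≤ σ → weight σ = 0 := by decide
    refine exists_isPoint hs hb hz ?_ ?_ ?_ ?_ ?_
    · fin_cases σ <;> first | rfl | exact absurd hσ (by decide)
    · simp [hw σ hσ]
    · simp [hw σ hσ]
    · simp [hw σ hσ]
    · rintro rfl
      exact absurd hσ (by decide)
  by_cases h2 : α 2 = 0 <;> by_cases h4 : α 4 = 0 <;> by_cases h5 : α 5 = 0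
  · exact absurd (by simp [discriminant, h2, h4, h5]) hd
  · refine key 9 (by decide) h5 ?_
    simp [support, Fin.forall_fin_succ, h2, h4]
  · refine key 8 (by decide) h4 ?_
    simp [support, Fin.forall_fin_succ, h2, h5]
  · refine key 6 (by decide) h4 ?_
    simp [support, Fin.forall_fin_succ, h2]
    simp_all
  · refine key 7 (by decide) h2 ?_
    simp [support, Fin.forall_fin_succ, h4, h5]
  · refine key 5 (by decide) h5 ?_
    simp [support, Fin.forall_fin_succ, h4]
    simp_all
  · refine key 4 (by decide) h2 ?_
    simp [support, Fin.forall_fin_succ, h5]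
    simp_all
  · refine absurd ?_ hd
    simp_all [discriminant]

lemma Solves.exists_isPoint_of_ne_zero {α : Fin 6 → ℂ} {c : ℂ} (hs : Solves α c) (hc : c ≠ 0) :
    ∃ σ β, IsPoint σ β ∧ ∃ r : ℂ, r ≠ 0 ∧ α = r • β ∧ c = r * lastEntry σ β := by
  obtain ⟨hd, -, h0, h1, h3⟩ := id hs
  simp only [mul_eq_zero, sub_eq_zero] at h0 h1 h3
  have h2 : α 2 ≠ 0 := fun h => hd (by simp_all [discriminant])
  have h4 : α 4 ≠ 0 := fun h => hd (by simp_all [discriminant])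
  have h5 : α 5 ≠ 0 := fun h => hd (by simp_all [discriminant])
  by_cases z0 : α 0 = 0 <;> by_cases z1 : α 1 = 0 <;> by_cases z3 : α 3 = 0
  · exact absurd (by simp [discriminant, z0, z1, z3]) hd
  · have e3 := h3.resolve_left z3
    refine exists_isPoint (σ := 3) hs h2 ?_ ?_ ?_ ?_ ?_ (fun h => absurd h (by decide))
    · simp [support, Fin.forall_fin_succ, z0, z1]
    · exact eq_div_of_mul_eq z3 e3.symm
    · simp [weight, z0]
    · simp [weight, z1]
    · simp [weight, e3]
  · have e1 := h1.resolve_left z1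
    refine exists_isPoint (σ := 2) hs h2 ?_ ?_ ?_ ?_ ?_ (fun h => absurd h (by decide))
    · simp [support, Fin.forall_fin_succ, z0, z3]
    · exact eq_div_of_mul_eq z1 e1.symm
    · simp [weight, z0]
    · simp [weight, e1]
    · simp [weight, z3]
  · have e1 := h1.resolve_left z1
    have e3 := h3.resolve_left z3
    refine absurd ?_ hd
    have : α 1 * α 4 = α 2 * α 3 := mul_left_cancel₀ hc (by linear_combination α 2 * e3 - α 4 * e1)
    simp only [discriminant, z0]
    linear_combination (α 1 * α 4 - α 2 * α 3) * this
  · have e0 := h0.resolve_left z0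
    refine exists_isPoint (σ := 1) hs h2 ?_ ?_ ?_ ?_ ?_ (fun h => absurd h (by decide))
    · simp [support, Fin.forall_fin_succ, z1, z3]
    · exact eq_div_of_mul_eq z0 e0.symm
    · simp [weight, e0]
    · simp [weight, z1]
    · simp [weight, z3]
  · have e0 := h0.resolve_left z0
    have e3 := h3.resolve_left z3
    refine absurd ?_ hd
    have : α 0 * α 5 = α 2 * α 3 := mul_left_cancel₀ hc (by linear_combination α 2 * e3 - α 5 * e0)
    simp only [discriminant, z1]
    linear_combination (α 0 * α 5 - α 2 * α 3) * this
  · have e0 := h0.resolve_left z0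
    have e1 := h1.resolve_left z1
    refine absurd ?_ hd
    have : α 0 * α 5 = α 1 * α 4 := mul_left_cancel₀ hc (by linear_combination α 4 * e1 - α 5 * e0)
    simp only [discriminant, z3]
    linear_combination (α 0 * α 5 - α 1 * α 4) * this
  · have e0 := h0.resolve_left z0
    have e1 := h1.resolve_left z1
    have e3 := h3.resolve_left z3
    have h05 : α 0 * α 5 = α 2 * α 3 :=
      mul_left_cancel₀ hc (by linear_combination α 2 * e3 - α 5 * e0)
    have h14 : α 1 * α 4 = α 2 * α 3 :=
      mul_left_cancel₀ hc (by linear_combination α 2 * e3 - α 4 * e1)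
    refine exists_isPoint (σ := 0) hs h2 ?_ ?_ ?_ ?_ ?_ (fun _ => ⟨h05, h14⟩)
    · simp [support]
    · exact eq_div_of_mul_eq z0 e0.symm
    · simp [weight, e0]
    · simp [weight, e1]
    · simp [weight, e3]

/-- The three points: the first three coordinate points. -/
def points : Fin 3 → Fin 4 → ℝ := ![![1, 0, 0, 0], ![0, 1, 0, 0], ![0, 0, 1, 0]]

/-- The three lines, spanned by integral points. -/
def lines (j : Fin 3) : Matrix (Fin 2) (Fin 4) ℝ :=
  .of ![fun a => lineStart j a, fun a => lineEnd j a]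

/-- The three planes: the coordinate planes through the last coordinate point. -/
def planes : Fin 3 → Matrix (Fin 3) (Fin 4) ℝ :=
  ![!![1, 0, 0, 0; 0, 1, 0, 0; 0, 0, 0, 1], !![1, 0, 0, 0; 0, 0, 1, 0; 0, 0, 0, 1],
    !![0, 1, 0, 0; 0, 0, 1, 0; 0, 0, 0, 1]]

/-- The symmetric matrices of the smooth quadrics satisfying all nine conditions. -/
def solutions : Set (Matrix (Fin 4) (Fin 4) ℂ) :=
  {X | X.IsSymm ∧ X.det ≠ 0 ∧
    (∀ i : Fin 3, (fun a => ((points i a : ℝ) : ℂ)) ⬝ᵥ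
      X.mulVec (fun a => ((points i a : ℝ) : ℂ)) = 0) ∧
    (∀ j : Fin 3,
      ((lines j).map ((↑) : ℝ → ℂ) * X * ((lines j).map ((↑) : ℝ → ℂ))ᵀ).det = 0) ∧
    (∀ k : Fin 3,
      ((planes k).map ((↑) : ℝ → ℂ) * X * ((planes k).map ((↑) : ℝ → ℂ))ᵀ).det = 0)}

lemma det_quadric (α : Fin 6 → ℂ) (c : ℂ) : (quadric α c).det = discriminant α c := by
  simp [quadric, Matrix.det_succ_row_zero, Fin.sum_univ_succ, Fin.succAbove, discriminant]
  ring

lemma dotProduct_points_mulVec (X : Matrix (Fin 4) (Fin 4) ℂ) (i : Fin 3) :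
    (fun a => ((points i a : ℝ) : ℂ)) ⬝ᵥ X.mulVec (fun a => ((points i a : ℝ) : ℂ)) =
      X i.castSucc i.castSucc := by
  fin_cases i <;>
    simp [points, dotProduct, Matrix.mulVec, Fin.sum_univ_four]

lemma det_lines (j : Fin 3) (α : Fin 6 → ℂ) (c : ℂ) :
    ((lines j).map ((↑) : ℝ → ℂ) * quadric α c * ((lines j).map ((↑) : ℝ → ℂ))ᵀ).det =
      lineForm (lineStart j) (lineEnd j) α c := by
  rw [lineForm, quadEval_tangency, quadEval_correction]
  simp [lines, quadric, Matrix.det_fin_two, Matrix.mul_apply, Fin.sum_univ_four, Fin.sum_univ_six,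
    polar, edge]
  ring

lemma det_planes (α : Fin 6 → ℂ) (c : ℂ) (k : Fin 3) :
    ((planes k).map ((↑) : ℝ → ℂ) * quadric α c * ((planes k).map ((↑) : ℝ → ℂ))ᵀ).det =
      ![α 0 * (2 * α 2 * α 4 - c * α 0), α 1 * (2 * α 2 * α 5 - c * α 1),
        α 3 * (2 * α 4 * α 5 - c * α 3)] k := by
  fin_cases k <;>
  · simp [planes, quadric, Matrix.det_fin_three, Matrix.mul_apply, Fin.sum_univ_four]
    ring

lemma quadric_isSymm (α : Fin 6 → ℂ) (c : ℂ) : (quadric α c).IsSymm := by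
  ext i j
  fin_cases i <;> fin_cases j <;> rfl

lemma quadric_mem_solutions_iff {α : Fin 6 → ℂ} {c : ℂ} :
    quadric α c ∈ solutions ↔ Solves α c := by
  simp only [solutions, Set.mem_ofPred_eq, det_quadric, dotProduct_points_mulVec, det_lines,
    det_planes, quadric_isSymm, true_and, Solves, and_congr_right_iff]
  intro _
  have h0 : ∀ i : Fin 3, quadric α c i.castSucc i.castSucc = 0 := by
    intro i
    fin_cases i <;> rfl
  simp [h0, Fin.forall_fin_succ]

lemma exists_eq_quadric {X : Matrix (Fin 4) (Fin 4) ℂ} (hX : X ∈ solutions) :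
    ∃ α c, X = quadric α c := by
  obtain ⟨hs, -, hp, -⟩ := hX
  simp only [dotProduct_points_mulVec] at hp
  refine ⟨fun e => X (edge e).1 (edge e).2, X 3 3, ?_⟩
  ext i j
  fin_cases i <;> fin_cases j <;>
    first | rfl | exact hp 0 | exact hp 1 | exact hp 2 | exact hs.apply _ _

lemma exists_eq_smul_quadric {X : Matrix (Fin 4) (Fin 4) ℂ} (hX : X ∈ solutions) :
    ∃ σ β, IsPoint σ β ∧ ∃ r : ℂˣ, X = (r : ℂ) • quadric β (lastEntry σ β) := by
  obtain ⟨α, c, rfl⟩ := exists_eq_quadric hX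
  have hs := quadric_mem_solutions_iff.1 hX
  have key : ∃ σ β, IsPoint σ β ∧ ∃ r : ℂ, r ≠ 0 ∧ α = r • β ∧ c = r * lastEntry σ β := by
    rcases eq_or_ne c 0 with rfl | hc
    · exact hs.exists_isPoint_of_eq_zero
    · exact hs.exists_isPoint_of_ne_zero hc
  obtain ⟨σ, β, hβ, r, hr, rfl, rfl⟩ := key
  refine ⟨σ, β, hβ, Units.mk0 r hr, ?_⟩
  ext i j
  fin_cases i <;> fin_cases j <;> simp [quadric]

lemma support_injective : Function.Injective support := by
  unfold Function.Injective
  decide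

lemma mem_support_iff_ne_zero {σ : Fin 10} {α : Fin 6 → ℂ} (h : IsPoint σ α)
    (hn : IsNondegenerate σ α) (e : Fin 6) : e ∈ support σ ↔ α e ≠ 0 :=
  ⟨hn.1 e, fun he => by_contra fun h' => he (h.2.1 e h')⟩

lemma eq_of_quadric_eq_smul {σ τ : Fin 10} {α β : Fin 6 → ℂ} {c d r : ℂ} (hα : IsPoint σ α)
    (hα' : IsNondegenerate σ α) (hβ : IsPoint τ β) (hβ' : IsNondegenerate τ β) (hr : r ≠ 0)
    (h : quadric α c = r • quadric β d) : σ = τ ∧ α = β := by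
  have he : ∀ e, α e = r * β e := by
    have h' : ∀ γ b e, quadric γ b (edge e).1 (edge e).2 = γ e := by
      intro γ b e
      fin_cases e <;> rfl
    intro e
    rw [← h' α c, h, Matrix.smul_apply, h' β d, smul_eq_mul]
  have hστ : σ = τ := support_injective <| by
    ext e
    rw [mem_support_iff_ne_zero hα hα', mem_support_iff_ne_zero hβ hβ', he]
    simp [hr]
  subst hστ
  have h1 := he (base σ)
  rw [hα.1, hβ.1, mul_one] at h1
  refine ⟨rfl, funext fun e => ?_⟩
  rw [he, ← h1, one_mul]

lemma lastEntry_ofReal (σ : Fin 10) (β : Fin 6 → ℝ) :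
    ∃ r : ℝ, lastEntry σ (fun e => (β e : ℂ)) = r := by
  refine ⟨![2 * β 2 * β 4 / β 0, 2 * β 2 * β 4 / β 0, 2 * β 2 * β 5 / β 1, 2 * β 4 * β 5 / β 3,
    0, 0, 0, 0, 0, 0] σ, ?_⟩
  fin_cases σ <;> simp [lastEntry]

lemma quadric_ofReal (β : Fin 6 → ℝ) (c : ℝ) (i j : Fin 4) :
    ∃ r : ℝ, quadric (fun e => (β e : ℂ)) c i j = r := by
  refine ⟨(!![0, β 0, β 1, β 2; β 0, 0, β 3, β 4; β 1, β 3, 0, β 5; β 2, β 4, β 5, c] :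
    Matrix (Fin 4) (Fin 4) ℝ) i j, ?_⟩
  fin_cases i <;> fin_cases j <;> simp [quadric]

lemma smul_class_eq_iff {X Y : Matrix (Fin 4) (Fin 4) ℂ} :
    {Z | ∃ c : ℂˣ, Z = (c : ℂ) • X} = {Z | ∃ c : ℂˣ, Z = (c : ℂ) • Y} ↔
      ∃ c : ℂˣ, X = (c : ℂ) • Y := by
  constructor
  · intro h
    have : X ∈ {Z | ∃ c : ℂˣ, Z = (c : ℂ) • X} := ⟨1, by simp⟩
    rwa [h] at this
  · rintro ⟨c, rfl⟩
    ext Z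
    constructor
    · rintro ⟨d, rfl⟩
      exact ⟨d * c, by simp [smul_smul]⟩
    · rintro ⟨d, rfl⟩
      exact ⟨d * c⁻¹, by simp [smul_smul]⟩

/-- There exist three points `pᵢ ∈ ℝ⁴`, three 2×4 real matrices
`Lⱼ` and three 3×4 real matrices `Hₖ` such that the set of equivalence classes,
under multiplication by nonzero complex scalars, of symmetric 4×4 complex
matrices `X` with `det X ≠ 0` satisfying `pᵢ X pᵢᵀ = 0`, `det(Lⱼ X Lⱼᵀ) = 0`
and `det(Hₖ X Hₖᵀ) = 0` for all `i, j, k`, is finite with exactly 104 elements,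
and every class contains a matrix with all entries real. -/
theorem fully_real_333 :
    ∃ (p : Fin 3 → Fin 4 → ℝ) (L : Fin 3 → Matrix (Fin 2) (Fin 4) ℝ)
      (H : Fin 3 → Matrix (Fin 3) (Fin 4) ℝ),
      let Sol : Set (Matrix (Fin 4) (Fin 4) ℂ) :=
        {X | X.IsSymm ∧ X.det ≠ 0 ∧
          (∀ i : Fin 3,
            (fun a => ((p i a : ℝ) : ℂ)) ⬝ᵥ X.mulVec (fun a => ((p i a : ℝ) : ℂ)) = 0) ∧
          (∀ j : Fin 3,
            ((L j).map ((↑) : ℝ → ℂ) * X * ((L j).map ((↑) : ℝ → ℂ))ᵀ).det = 0) ∧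
          (∀ k : Fin 3,
            ((H k).map ((↑) : ℝ → ℂ) * X * ((H k).map ((↑) : ℝ → ℂ))ᵀ).det = 0)}
      let S : Set (Set (Matrix (Fin 4) (Fin 4) ℂ)) :=
        (fun X => {Y | ∃ c : ℂˣ, Y = (c : ℂ) • X}) '' Sol
      S.Finite ∧ S.ncard = 104 ∧
        ∀ A ∈ S, ∃ Y ∈ A, ∀ i j : Fin 4, ∃ r : ℝ, Y i j = (r : ℂ) := by
  refine ⟨points, lines, planes, ?_⟩
  intro Sol S
  choose P hcard hcomplete hP using exists_complete_points
  set f : (Σ _ : Fin 10, Fin 6 → ℂ) → Set (Matrix (Fin 4) (Fin 4) ℂ) := fun x =>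
    {Y | ∃ c : ℂˣ, Y = (c : ℂ) • quadric x.2 (lastEntry x.1 x.2)} with hf
  have hS : S = f '' (Finset.univ.sigma P : Finset (Σ _ : Fin 10, Fin 6 → ℂ)) := by
    ext A
    constructor
    · rintro ⟨X, hX, rfl⟩
      obtain ⟨σ, β, hβ, r, hr⟩ := exists_eq_smul_quadric hX
      exact ⟨⟨σ, β⟩, by simpa using hcomplete σ β hβ, (smul_class_eq_iff.2 ⟨r, hr⟩).symm⟩
    · rintro ⟨⟨σ, β⟩, h, rfl⟩
      have h' := hP σ β (by simpa using h)
      exact ⟨_, quadric_mem_solutions_iff.2 (solves_of_isPoint h'.1 h'.2.1), rfl⟩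
  have hinj : Set.InjOn f (Finset.univ.sigma P : Finset (Σ _ : Fin 10, Fin 6 → ℂ)) := by
    rintro ⟨σ, α⟩ hα ⟨τ, β⟩ hβ h
    have hα' := hP σ α (by simpa using hα)
    have hβ' := hP τ β (by simpa using hβ)
    obtain ⟨r, hr⟩ := smul_class_eq_iff.1 h
    obtain ⟨rfl, rfl⟩ := eq_of_quadric_eq_smul hα'.1 hα'.2.1 hβ'.1 hβ'.2.1 r.ne_zero hr
    rfl
  refine ⟨hS ▸ (Finset.finite_toSet _).image f, ?_, ?_⟩
  · rw [hS, hinj.ncard_image, Set.ncard_coe_finset, Finset.card_sigma]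
    simp only [hcard]
    decide
  · rw [hS]
    rintro _ ⟨⟨σ, α⟩, hα, rfl⟩
    obtain ⟨-, -, β, rfl⟩ := hP σ α (by simpa using hα)
    obtain ⟨c, hc⟩ := lastEntry_ofReal σ β
    refine ⟨quadric (fun e => (β e : ℂ)) c, ⟨1, ?_⟩, quadric_ofReal β c⟩
    simp [hc]
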